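/- Let G be a finite abelian group, A = M_{x_0} \otimes \bigotimes_{i=1}^\infty M_{a_i} a direct limit of elementarily G-graded matrix algebras with supp(x_0) = supp(a_i) = S for all i, and c \in Z_{\geq 0}G. Then A \otimes M_c \cong A as G-graded algebras if and only if \bar{c} K^+ = K^+, where K^+ is the positive cone of K_0^{gr}(A) realized inside L_S. -/

import Mathlib

noncomputable section

open scoped TensorProduct

/-- A `G`-grading on the `F`-algebra `A`: the components multiply according to the group law,
`1` is homogeneous of trivial degree, and `A` is the internal direct sum of the components. -/
def IsGrading (F : Type) [Field F] {G : Type} [CommGroup G] [DecidableEq G]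
    {A : Type} [Ring A] [Algebra F A] (𝒜 : G → Submodule F A) : Prop :=
  (1 : A) ∈ 𝒜 1 ∧
  (∀ {g h : G} {a b : A}, a ∈ 𝒜 g → b ∈ 𝒜 h → a * b ∈ 𝒜 (g * h)) ∧
  DirectSum.IsInternal 𝒜

/-- Isomorphism of `G`-graded algebras: an algebra isomorphism matching up the
homogeneous components. -/
def IsGradedAlgIso (F : Type) [Field F] {G : Type} [CommGroup G]
    {A B : Type} [Ring A] [Algebra F A] [Ring B] [Algebra F B]
    (𝒜 : G → Submodule F A) (ℬ : G → Submodule F B) : Prop :=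
  ∃ e : A ≃ₐ[F] B, ∀ g, (𝒜 g).map e.toLinearMap = ℬ g

/-- A homomorphism of graded algebras: it maps each component into the corresponding one. -/
def IsGradedHom (F : Type) [Field F] {G : Type} [CommGroup G]
    {A B : Type} [Ring A] [Algebra F A] [Ring B] [Algebra F B]
    (𝒜 : G → Submodule F A) (ℬ : G → Submodule F B) (f : A →ₐ[F] B) : Prop :=
  ∀ g, (𝒜 g).map f.toLinearMap ≤ ℬ g

/-- The `G`-grading on the matrix algebra `M_ι(A)` induced by a tuple `γ : ι → G` and the
grading `𝒜` of `A`: `deg (E i j a) = γ i * deg a * (γ j)⁻¹`. -/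
def matrixGrading {F : Type} [Field F] {G : Type} [CommGroup G]
    {A : Type} [Ring A] [Algebra F A] {ι : Type} (γ : ι → G)
    (𝒜 : G → Submodule F A) (g : G) : Submodule F (Matrix ι ι A) where
  carrier := {M | ∀ i j, M i j ∈ 𝒜 ((γ i)⁻¹ * g * γ j)}
  add_mem' := fun hM hN i j => add_mem (hM i j) (hN i j)
  zero_mem' := fun i j => zero_mem _
  smul_mem' := fun c M hM i j => Submodule.smul_mem _ c (hM i j)

/-- The trivial grading on the base field. -/
def trivGrading (F : Type) [Field F] (G : Type) [CommGroup G] [DecidableEq G]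
    (g : G) : Submodule F F :=
  if g = 1 then ⊤ else ⊥

/-- The elementary grading on a matrix algebra over `F` determined by the tuple `γ`. -/
def elemGrading {F : Type} [Field F] {G : Type} [CommGroup G] [DecidableEq G]
    {ι : Type} (γ : ι → G) : G → Submodule F (Matrix ι ι F) :=
  matrixGrading γ (trivGrading F G)

/-- `γ` is a tuple representing the multiset `x` of elements of `G`. -/
def Reps {G : Type} [CommGroup G] {n : ℕ} (γ : Fin n → G) (x : Multiset G) : Prop :=
  Multiset.map γ Finset.univ.val = x

/-- Product of multisets of group elements, corresponding to the product in the
group semiring `ℤ≥0 G`. -/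
def mmul {G : Type} [CommGroup G] (x y : Multiset G) : Multiset G :=
  x.bind fun g => y.map (g * ·)

/-- The image of a multiset under `g ↦ g⁻¹`, corresponding to the bar involution of `ℤG`. -/
def mbarM {G : Type} [CommGroup G] (x : Multiset G) : Multiset G :=
  x.map fun g => g⁻¹

/-- The grading of a tensor product of graded algebras: `deg (a ⊗ b) = deg a * deg b`. -/
def tensorGrading (F : Type) [Field F] {G : Type} [CommGroup G]
    {A B : Type} [Ring A] [Algebra F A] [Ring B] [Algebra F B]
    (𝒜 : G → Submodule F A) (ℬ : G → Submodule F B) (g : G) : Submodule F (A ⊗[F] B) :=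
  ⨆ p : {p : G × G // p.1 * p.2 = g},
    Submodule.map₂ (TensorProduct.mk F A B) (𝒜 p.1.1) (ℬ p.1.2)

/-- The grading induced on a subalgebra (e.g. a centralizer) of a graded algebra. -/
def subGrading {F : Type} [Field F] {G : Type} [CommGroup G]
    {B : Type} [Ring B] [Algebra F B] (C : Subalgebra F B)
    (ℬ : G → Submodule F B) (g : G) : Submodule F C :=
  (ℬ g).comap C.val.toLinearMap

/-- The grading on the opposite algebra, with the same homogeneous components. -/
def opGrading {F : Type} [Field F] {G : Type} [CommGroup G]
    {A : Type} [Ring A] [Algebra F A] (𝒜 : G → Submodule F A) (g : G) : Submodule F Aᵐᵒᵖ :=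
  (𝒜 g).map (MulOpposite.opLinearEquiv F).toLinearMap

/-- The grading on `End_F(A)` induced by a grading of `A`: a map is homogeneous of degree `g`
if it maps `A_h` into `A_{g h}` for all `h`. -/
def endGrading {F : Type} [Field F] {G : Type} [CommGroup G]
    {A : Type} [Ring A] [Algebra F A] (𝒜 : G → Submodule F A) (g : G) :
    Submodule F (Module.End F A) where
  carrier := {f | ∀ h : G, ∀ a ∈ 𝒜 h, f a ∈ 𝒜 (g * h)}
  add_mem' := fun hf hf' h a ha => add_mem (hf h a ha) (hf' h a ha)
  zero_mem' := fun _ _ _ => zero_mem _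
  smul_mem' := fun c f hf h a ha => Submodule.smul_mem _ c (hf h a ha)
/-- Evaluation of a complex character of `G` on a multiset (an element of `ℤ≥0 G`). -/
def evChar {G : Type} [CommGroup G] (χ : G →* ℂˣ) (x : Multiset G) : ℂ :=
  (x.map fun g => (χ g : ℂ)).sum

/-- The support of an element of `ℤ≥0 G ⊆ ℚG`, recorded as the (Galois-stable) set of
characters not vanishing on it; it corresponds to the set of Wedderburn components of `ℚG`
on which the element has nonzero projection. -/
def suppM {G : Type} [CommGroup G] (x : Multiset G) : Set (G →* ℂˣ) :=
  {χ | evChar χ x ≠ 0}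
open Classical

/-- `b i = \bar a 1 ⋯ \bar a i`: the product of the bars of the labels. -/
def bprod {G : Type} [CommGroup G] (a : ℕ → Multiset G) : ℕ → Multiset G
  | 0 => {1}
  | i + 1 => mmul (bprod a i) (mbarM (a i))

/-- The explicit realization, inside the Wedderburn components indexed by the characters
in `S`, of the positive cone `K⁺ = ⋃_i (1/π_S(b i)) π_S(ℤ≥0 G)` of the graded Grothendieck
group of the limit `M_{x 0} ⊗ ⊗_i M_{a i}`. Functions vanish outside `S`. -/
def Kplus {G : Type} [CommGroup G] (S : Set (G →* ℂˣ)) (a : ℕ → Multiset G) :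
    Set ((G →* ℂˣ) → ℂ) :=
  {f | ∃ (i : ℕ) (c : Multiset G), ∀ χ : G →* ℂˣ,
    f χ = if χ ∈ S then evChar χ c / evChar χ (bprod a i) else 0}

/-- The projection `π_S` of an element of `ℤ≥0 G ⊆ ℚG` to the components indexed by `S`. -/
def piS {G : Type} [CommGroup G] (S : Set (G →* ℂˣ)) (x : Multiset G) : (G →* ℂˣ) → ℂ :=
  fun χ => if χ ∈ S then evChar χ x else 0

/-- Multiplication of a subset of `L_S` by (the projection of) an element of `ℤ≥0 G`. -/
def mscale {G : Type} [CommGroup G] (b : Multiset G) (K : Set ((G →* ℂˣ) → ℂ)) :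
    Set ((G →* ℂˣ) → ℂ) :=
  (fun f χ => evChar χ b * f χ) '' K
/-- `(L, ℒ)` is a direct limit of the chain of unital graded embeddings
`ι i : A i → A (i+1)`: there are compatible injective unital graded homomorphisms
`φ i : A i → L` whose images exhaust `L` as well as each homogeneous component of `L`. -/
def IsGradedDirectLimit (F : Type) [Field F] {G : Type} [CommGroup G]
    (A : ℕ → Type) [∀ i, Ring (A i)] [∀ i, Algebra F (A i)]
    (𝒜 : ∀ i, G → Submodule F (A i)) (ι : ∀ i, A i →ₐ[F] A (i + 1))
    {L : Type} [Ring L] [Algebra F L] (ℒ : G → Submodule F L) : Prop :=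
  ∃ φ : ∀ i, A i →ₐ[F] L,
    (∀ i, Function.Injective (φ i)) ∧
    (∀ i, (φ (i + 1)).comp (ι i) = φ i) ∧
    (∀ z : L, ∃ i, z ∈ (φ i).range) ∧
    (∀ g, (ℒ g : Set L) = ⋃ i, (φ i) '' (𝒜 i g))
/-- The unital embedding `ι : M_γ(F) → M_δ(F)` of elementarily graded matrix algebras has
label `η`: the centralizer of its image, with the induced grading, is graded-isomorphic to
the matrix algebra with elementary grading `η`. -/
def HasLabel {F : Type} [Field F] {G : Type} [CommGroup G] [DecidableEq G]
    {n m k : ℕ} (γ : Fin n → G) (δ : Fin m → G) (η : Fin k → G)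
    (ι : Matrix (Fin n) (Fin n) F →ₐ[F] Matrix (Fin m) (Fin m) F) : Prop :=
  IsGradedHom F (elemGrading γ) (elemGrading δ) ι ∧
  IsGradedAlgIso F
    (subGrading (Subalgebra.centralizer F (Set.range ι)) (elemGrading δ))
    (elemGrading η)

/-- `(L, ℒ)` is the direct limit `M_{x 0} ⊗ ⊗_{i} M_{a i}` of matrix algebras with elementary
`G`-gradings: the `i`-th algebra is `M_{x i}(F)` and the `i`-th unital graded embedding
has label `a i`, so that `x (i+1) = x i * a i`. -/
def IsElemLimit (F : Type) [Field F] {G : Type} [CommGroup G] [DecidableEq G]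
    (L : Type) [Ring L] [Algebra F L] (ℒ : G → Submodule F L)
    (x a : ℕ → Multiset G) : Prop :=
  (∀ i, x (i + 1) = mmul (x i) (a i)) ∧
  ∃ (n : ℕ → ℕ) (γ : ∀ i, Fin (n i) → G) (k : ℕ → ℕ) (η : ∀ i, Fin (k i) → G)
    (ι : ∀ i, Matrix (Fin (n i)) (Fin (n i)) F →ₐ[F]
      Matrix (Fin (n (i + 1))) (Fin (n (i + 1))) F),
    (∀ i, Reps (γ i) (x i)) ∧ (∀ i, Reps (η i) (a i)) ∧
    (∀ i, Function.Injective (ι i)) ∧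
    (∀ i, HasLabel (γ i) (γ (i + 1)) (η i) (ι i)) ∧
    IsGradedDirectLimit F _ (fun i => elemGrading (γ i)) ι ℒ

/-- `(L, ℒ)` is a direct limit of matrix algebras over `F` endowed with (arbitrary)
`G`-gradings, along unital graded embeddings. -/
def IsMatrixLimit (F : Type) [Field F] {G : Type} [CommGroup G] [DecidableEq G]
    (L : Type) [Ring L] [Algebra F L] (ℒ : G → Submodule F L) : Prop :=
  ∃ (n : ℕ → ℕ) (Mg : ∀ i, G → Submodule F (Matrix (Fin (n i)) (Fin (n i)) F))
    (ι : ∀ i, Matrix (Fin (n i)) (Fin (n i)) F →ₐ[F]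
      Matrix (Fin (n (i + 1))) (Fin (n (i + 1))) F),
    (∀ i, IsGrading F (Mg i)) ∧
    (∀ i, IsGradedHom F (Mg i) (Mg (i + 1)) (ι i)) ∧
    IsGradedDirectLimit F _ Mg ι ℒ

/-- `(L, ℒ)` is a direct limit of matrix algebras over `F` endowed with elementary
`G`-gradings, along unital graded embeddings. -/
def IsElemMatrixLimit (F : Type) [Field F] {G : Type} [CommGroup G] [DecidableEq G]
    (L : Type) [Ring L] [Algebra F L] (ℒ : G → Submodule F L) : Prop :=
  ∃ (n : ℕ → ℕ) (γ : ∀ i, Fin (n i) → G)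
    (ι : ∀ i, Matrix (Fin (n i)) (Fin (n i)) F →ₐ[F]
      Matrix (Fin (n (i + 1))) (Fin (n (i + 1))) F),
    (∀ i, Function.Injective (ι i)) ∧
    (∀ i, IsGradedHom F (elemGrading (γ i)) (elemGrading (γ (i + 1))) (ι i)) ∧
    IsGradedDirectLimit F _ (fun i => elemGrading (γ i)) ι ℒ

open scoped TensorProduct

section Characters

variable {G : Type} [CommGroup G]

/-- The multiset of values of a finite family of group elements. -/
def labels {K : Type} [Fintype K] (η : K → G) : Multiset G := Finset.univ.val.map η

/-- The family of pairwise products of two families of group elements. -/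
def pmul {I K : Type} (γ : I → G) (η : K → G) : I × K → G := fun p => γ p.1 * η p.2

theorem evChar_labels {K : Type} [Fintype K] (χ : G →* ℂˣ) (η : K → G) :
    evChar χ (labels η) = ∑ k, (χ (η k) : ℂ) := by
  simp only [evChar, labels, Multiset.map_map, Function.comp_def]
  rfl

theorem evChar_mmul (χ : G →* ℂˣ) (x y : Multiset G) :
    evChar χ (mmul x y) = evChar χ x * evChar χ y := by
  simp [evChar, mmul, Multiset.map_bind, Multiset.sum_bind, Multiset.sum_map_mul_left,
    Multiset.sum_map_mul_right]

theorem evChar_labels_pmul {I K : Type} [Fintype I] [Fintype K] (χ : G →* ℂˣ)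
    (γ : I → G) (η : K → G) :
    evChar χ (labels (pmul γ η)) = evChar χ (labels γ) * evChar χ (labels η) := by
  simp [evChar_labels, pmul, Fintype.sum_prod_type, Finset.sum_mul_sum]

theorem evChar_one (x : Multiset G) : evChar 1 x = x.card := by
  simp [evChar]

theorem evChar_mbarM [Finite G] (χ : G →* ℂˣ) (x : Multiset G) :
    evChar χ (mbarM x) = (starRingEnd ℂ) (evChar χ x) := by
  have h : ∀ g, ((χ g⁻¹ : ℂˣ) : ℂ) = (starRingEnd ℂ) (χ g : ℂ) := by
    intro g
    have h1 : ‖(χ g : ℂ)‖ = 1 := by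
      refine Complex.norm_eq_one_of_pow_eq_one (n := Nat.card G) ?_ Nat.card_pos.ne'
      rw [← Units.val_pow_eq_pow_val, ← map_pow, pow_card_eq_one']
      simp
    rw [map_inv, Units.val_inv_eq_inv_val, Complex.inv_def, Complex.normSq_eq_norm_sq, h1]
    simp
  simp only [evChar, mbarM, map_multiset_sum, Multiset.map_map, Function.comp_def, h]

theorem multiset_eq_of_evChar_eq [Finite G] {x y : Multiset G}
    (h : ∀ χ : G →* ℂˣ, evChar χ x = evChar χ y) : x = y := by
  have := Fintype.ofFinite G
  have hev : ∀ (z : Multiset G) (χ : G →* ℂˣ),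
      evChar χ z = ∑ g, (z.count g : ℂ) * (χ g : ℂ) := by
    intro z χ
    rw [evChar, Finset.sum_multiset_map_count]
    simp only [nsmul_eq_mul]
    refine Finset.sum_subset (Finset.subset_univ _) ?_
    intro g _ hg
    simp [Multiset.count_eq_zero_of_notMem (by simpa using hg)]
  let ev : G → ((G →* ℂˣ) →* ℂ) := fun g =>
    { toFun := fun χ => (χ g : ℂ), map_one' := by simp, map_mul' := by simp }
  have hinj : Function.Injective ev := by
    intro g g' hg
    by_contra hne
    obtain ⟨χ, hχ⟩ := CommGroup.exists_apply_ne_one_of_hasEnoughRootsOfUnity G ℂ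
      (a := g * g'⁻¹) (by simpa [mul_inv_eq_one] using hne)
    apply hχ
    have := DFunLike.congr_fun hg χ
    rw [map_mul, map_inv, mul_inv_eq_one]
    exact Units.ext this
  have hli := (linearIndependent_monoidHom (G →* ℂˣ) ℂ).comp ev hinj
  have := Fintype.linearIndependent_iff.mp hli (fun g => (x.count g : ℂ) - y.count g) (by
    funext χ
    have := h χ
    rw [hev, hev, ← sub_eq_zero, ← Finset.sum_sub_distrib] at this
    simpa [ev, sub_mul] using this)
  ext g
  have := this g
  rw [sub_eq_zero] at this
  exact_mod_cast this

theorem labels_pmul {I K : Type} [Fintype I] [Fintype K] (γ : I → G) (η : K → G) :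
    labels (pmul γ η) = mmul (labels γ) (labels η) := by
  simp only [labels, pmul, mmul, Multiset.bind_map, Multiset.map_map, Function.comp_def]
  rw [← Finset.univ_product_univ, Finset.product_val]
  simp [SProd.sprod, Multiset.product, Multiset.map_bind]
  rfl

theorem exists_equiv_of_labels_eq {I J : Type} [Fintype I] [Fintype J] {γ : I → G} {δ : J → G}
    (h : labels γ = labels δ) : ∃ σ : I ≃ J, ∀ i, δ (σ i) = γ i := by
  have hc : ∀ g, Nonempty ({i // γ i = g} ≃ {j // δ j = g}) := by
    intro g
    rw [← Fintype.card_eq, Fintype.card_subtype, Fintype.card_subtype]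
    have := congrArg (Multiset.count g) h
    simp only [labels, Multiset.count_map] at this
    simpa [Finset.card, eq_comm] using this
  have e := fun g => (hc g).some
  exact ⟨Equiv.ofFiberEquiv e, fun i => Equiv.ofFiberEquiv_map e i⟩

theorem labels_eq_of_equiv {I J : Type} [Fintype I] [Fintype J] {γ : I → G} {δ : J → G}
    (σ : I ≃ J) (h : ∀ i, δ (σ i) = γ i) : labels γ = labels δ := by
  have : γ = δ ∘ σ := by funext i; simp [h]
  rw [labels, labels, this, ← Multiset.map_map]
  congr 1
  exact congrArg Finset.val (Finset.map_univ_equiv σ)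

theorem exists_labels_eq (x : Multiset G) : ∃ (k : ℕ) (η : Fin k → G), labels η = x := by
  refine ⟨x.toList.length, x.toList.get, ?_⟩
  simp only [labels, Fin.univ_val_map, List.ofFn_get, Multiset.coe_toList]

end Characters

section Matrices

variable {F : Type} [Field F] {G : Type} [CommGroup G]

/-- A rectangular matrix whose columns, indexed by `ε`, are homogeneous with respect to the
degrees `δ` of the rows. -/
def Homog {J X : Type} (δ : J → G) (ε : X → G) (P : Matrix J X F) : Prop :=
  ∀ s x, P s x ≠ 0 → δ s = ε x

theorem Homog.mul {I J K : Type} [Fintype J] {α : I → G} {β : J → G} {γ : K → G}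
    {P : Matrix I J F} {Q : Matrix J K F} (hP : Homog α β P) (hQ : Homog β γ Q) :
    Homog α γ (P * Q) := by
  intro i k h
  rw [Matrix.mul_apply] at h
  obtain ⟨j, -, hj⟩ := Finset.exists_ne_zero_of_sum_ne_zero h
  exact (hP i j (left_ne_zero_of_mul hj)).trans (hQ j k (right_ne_zero_of_mul hj))

theorem Homog.of_mul_eq_one {J X : Type} [Fintype J] [Fintype X] [DecidableEq J] [DecidableEq X]
    {δ : J → G} {ε : X → G} {P : Matrix J X F} {Q : Matrix X J F} (hP : Homog δ ε P)
    (h1 : P * Q = 1) (h2 : Q * P = 1) : Homog ε δ Q := by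
  let Q' : Matrix X J F := fun x s => if ε x = δ s then Q x s else 0
  have h3 : P * Q' = 1 := by
    rw [← h1]
    ext s t
    by_cases hst : δ s = δ t
    · simp only [Matrix.mul_apply]
      refine Finset.sum_congr rfl fun x _ => ?_
      by_cases hx : P s x = 0
      · simp [hx]
      · simp [Q', ← hP s x hx, hst]
    · have h0 : (P * Q) s t = 0 := by
        rw [h1, Matrix.one_apply_ne]
        rintro rfl
        exact hst rfl
      rw [h0, Matrix.mul_apply]
      refine Finset.sum_eq_zero fun x _ => ?_
      by_cases hx : P s x = 0
      · simp [hx]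
      · simp [Q', ← hP s x hx, hst]
  have h4 : Q = Q' := by
    calc Q = Q * (P * Q') := by rw [h3, Matrix.mul_one]
      _ = Q' := by rw [← Matrix.mul_assoc, h2, Matrix.one_mul]
  intro x s hne
  rw [h4] at hne
  by_contra hcon
  exact hne (if_neg hcon)

/-- The degrees of the rows and of the columns of an invertible homogeneous matrix agree. -/
theorem Homog.labels_eq {J X : Type} [Fintype J] [Fintype X] [DecidableEq J] [DecidableEq X]
    {δ : J → G} {ε : X → G} {P : Matrix J X F} {Q : Matrix X J F} (hP : Homog δ ε P)
    (h1 : P * Q = 1) (h2 : Q * P = 1) : labels δ = labels ε := by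
  have hcard : Fintype.card J = Fintype.card X := Matrix.square_of_invertible P Q h1 h2
  let e : X ≃ J := Fintype.equivOfCardEq hcard.symm
  have hdet : (P.submatrix id e.symm).det ≠ 0 := by
    have : P.submatrix id e.symm * Q.submatrix e.symm id = 1 := by
      rw [Matrix.submatrix_mul_equiv, h1, Matrix.submatrix_id_id]
    have := congrArg Matrix.det this
    rw [Matrix.det_mul, Matrix.det_one] at this
    exact left_ne_zero_of_mul (this ▸ one_ne_zero)
  rw [Matrix.det_apply] at hdet
  obtain ⟨σ, -, hσ⟩ := Finset.exists_ne_zero_of_sum_ne_zero hdet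
  have hσ' : ∀ j, P (σ j) (e.symm j) ≠ 0 := by
    intro j hj
    apply hσ
    rw [Finset.prod_eq_zero (Finset.mem_univ j) (by simpa using hj), smul_zero]
  exact (labels_eq_of_equiv (e.trans σ) fun x => by
    simpa using hP _ _ (hσ' (e x))).symm

theorem mem_elemGrading [DecidableEq G] {I : Type} {γ : I → G} {g : G} {M : Matrix I I F} :
    M ∈ elemGrading γ g ↔ ∀ i j, M i j ≠ 0 → γ i = g * γ j := by
  have h : ∀ i j (a : F),
      a ∈ trivGrading F G ((γ i)⁻¹ * g * γ j) ↔ (a ≠ 0 → γ i = g * γ j) := by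
    intro i j a
    have he : (γ i)⁻¹ * g * γ j = 1 ↔ γ i = g * γ j := by
      rw [mul_assoc, inv_mul_eq_one]
    unfold trivGrading
    split_ifs with h
    · exact ⟨fun _ _ => he.mp h, fun _ => Submodule.mem_top⟩
    · rw [Submodule.mem_bot]
      exact ⟨fun h0 h1 => absurd h0 h1, fun H => by_contra fun h0 => h (he.mpr (H h0))⟩
  exact ⟨fun H i j => (h i j _).mp (H i j), fun H i j => (h i j _).mpr (H i j)⟩

theorem mem_elemGrading_one [DecidableEq G] {I : Type} {γ : I → G} {M : Matrix I I F} :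
    M ∈ elemGrading γ 1 ↔ Homog γ γ M := by
  simp [mem_elemGrading, Homog]

theorem mul_mem_elemGrading [DecidableEq G] {I : Type} [Fintype I] {γ : I → G} {g h : G}
    {M N : Matrix I I F} (hM : M ∈ elemGrading γ g) (hN : N ∈ elemGrading γ h) :
    M * N ∈ elemGrading γ (g * h) := by
  rw [mem_elemGrading] at *
  intro i k hne
  rw [Matrix.mul_apply] at hne
  obtain ⟨j, -, hj⟩ := Finset.exists_ne_zero_of_sum_ne_zero hne
  rw [hM i j (left_ne_zero_of_mul hj), hN j k (right_ne_zero_of_mul hj), mul_assoc]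

theorem single_mem_elemGrading [DecidableEq G] {I : Type} [DecidableEq I] (γ : I → G) (i j : I)
    (a : F) : Matrix.single i j a ∈ elemGrading γ (γ i * (γ j)⁻¹) := by
  rw [mem_elemGrading]
  intro s t h
  rw [Matrix.single_apply] at h
  obtain ⟨rfl, rfl⟩ : i = s ∧ j = t := by_contra fun hc => h (if_neg hc)
  rw [inv_mul_cancel_right]

open scoped Kronecker

/-- A homomorphism of matrix algebras which, in homogeneous bases, is the tensor
multiplication by a graded vector space with degrees `η`. -/
def HasMult {I J K : Type} [Fintype I] [DecidableEq I] [Fintype J] [DecidableEq J]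
    [Fintype K] [DecidableEq K] (γ : I → G) (δ : J → G) (η : K → G)
    (f : Matrix I I F →ₐ[F] Matrix J J F) : Prop :=
  ∃ (P : Matrix J (I × K) F) (Q : Matrix (I × K) J F), P * Q = 1 ∧ Q * P = 1 ∧
    Homog δ (pmul γ η) P ∧ Homog (pmul γ η) δ Q ∧
    ∀ A, f A = P * (A ⊗ₖ (1 : Matrix K K F)) * Q

variable {I J K X : Type} [Fintype I] [DecidableEq I] [Fintype J] [DecidableEq J]
    [Fintype K] [DecidableEq K] [Fintype X] [DecidableEq X]
    {γ : I → G} {δ : J → G} {η : K → G}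
    {f : Matrix I I F →ₐ[F] Matrix J J F}

theorem HasMult.labels_eq (h : HasMult γ δ η f) : labels δ = mmul (labels γ) (labels η) := by
  obtain ⟨P, Q, h1, h2, hP, -, -⟩ := h
  rw [hP.labels_eq h1 h2, labels_pmul]

theorem HasMult.isGradedHom [DecidableEq G] (h : HasMult γ δ η f) :
    IsGradedHom F (elemGrading γ) (elemGrading δ) f := by
  obtain ⟨P, Q, h1, h2, hP, hQ, hf⟩ := h
  rintro g _ ⟨A, hA, rfl⟩
  rw [SetLike.mem_coe, mem_elemGrading] at hA
  change f A ∈ _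
  rw [hf, mem_elemGrading]
  intro s t hne
  rw [Matrix.mul_apply] at hne
  obtain ⟨⟨j, l⟩, -, h⟩ := Finset.exists_ne_zero_of_sum_ne_zero hne
  have hq := hQ _ _ (right_ne_zero_of_mul h)
  have h := left_ne_zero_of_mul h
  rw [Matrix.mul_apply] at h
  obtain ⟨⟨i, k⟩, -, h⟩ := Finset.exists_ne_zero_of_sum_ne_zero h
  have hp := hP _ _ (left_ne_zero_of_mul h)
  have h := right_ne_zero_of_mul h
  rw [Matrix.kronecker_apply] at h
  have h3 := hA _ _ (left_ne_zero_of_mul h)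
  have h4 : k = l := by
    by_contra hkl
    exact right_ne_zero_of_mul h (Matrix.one_apply_ne hkl)
  rw [hp, ← hq, pmul, pmul, h3, h4, mul_assoc]

theorem exists_hasMult_of_labels_eq (η : K → G)
    (h : labels δ = mmul (labels γ) (labels η)) :
    ∃ f : Matrix I I F →ₐ[F] Matrix J J F, HasMult γ δ η f := by
  obtain ⟨σ, hσ⟩ := exists_equiv_of_labels_eq (h.trans (labels_pmul γ η).symm)
  let P : Matrix J (I × K) F := (1 : Matrix (I × K) (I × K) F).submatrix σ id
  let Q : Matrix (I × K) J F := (1 : Matrix (I × K) (I × K) F).submatrix id σ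
  have h1 : P * Q = 1 := by
    rw [← Matrix.submatrix_mul _ _ _ id _ Function.bijective_id, Matrix.one_mul,
      Matrix.submatrix_one_equiv]
  have h2 : Q * P = 1 := by
    rw [Matrix.submatrix_mul_equiv, Matrix.one_mul, Matrix.submatrix_id_id]
  let f : Matrix I I F →ₗ[F] Matrix J J F :=
    { toFun := fun A => P * (A ⊗ₖ (1 : Matrix K K F)) * Q
      map_add' := fun A B => by rw [Matrix.add_kronecker, Matrix.mul_add, Matrix.add_mul]
      map_smul' := fun c A => by simp [Matrix.smul_kronecker] }
  refine ⟨AlgHom.ofLinearMap f ?_ ?_, P, Q, h1, h2, ?_, ?_, fun A => rfl⟩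
  · simp [f, h1]
  · intro A B
    simp only [f, LinearMap.coe_mk, AddHom.coe_mk]
    calc _ = P * ((A ⊗ₖ (1 : Matrix K K F)) * (B ⊗ₖ (1 : Matrix K K F))) * Q := by
            rw [← Matrix.mul_kronecker_mul, Matrix.mul_one]
      _ = P * (A ⊗ₖ (1 : Matrix K K F)) * (Q * P) * (B ⊗ₖ (1 : Matrix K K F)) * Q := by
            rw [h2]; simp only [Matrix.mul_assoc, Matrix.one_mul]
      _ = _ := by simp only [Matrix.mul_assoc]
  · intro s x hne
    have : σ s = x := by
      by_contra hc
      exact hne (Matrix.one_apply_ne hc)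
    rw [← this, hσ]
  · intro x s hne
    have : x = σ s := by
      by_contra hc
      exact hne (Matrix.one_apply_ne hc)
    rw [this, hσ]

theorem HasMult.comp {δ' : X → G} {K' : Type} [Fintype K'] [DecidableEq K'] {η' : K' → G}
    {f' : Matrix J J F →ₐ[F] Matrix X X F}
    (hf : HasMult γ δ η f) (hf' : HasMult δ δ' η' f') :
    HasMult γ δ' (pmul η η') (f'.comp f) := by
  obtain ⟨P, Q, h1, h2, hP, hQ, hf⟩ := hf
  obtain ⟨P', Q', h1', h2', hP', hQ', hf'⟩ := hf'
  let σ : I × (K × K') ≃ (I × K) × K' := (Equiv.prodAssoc I K K').symm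
  let U : Matrix X ((I × K) × K') F := P' * (P ⊗ₖ (1 : Matrix K' K' F))
  let V : Matrix ((I × K) × K') X F := (Q ⊗ₖ (1 : Matrix K' K' F)) * Q'
  have hUV : U * V = 1 := by
    calc U * V = P' * ((P ⊗ₖ (1 : Matrix K' K' F)) * (Q ⊗ₖ (1 : Matrix K' K' F))) * Q' := by
          simp only [U, V, Matrix.mul_assoc]
      _ = 1 := by
          rw [← Matrix.mul_kronecker_mul, h1, Matrix.mul_one, Matrix.one_kronecker_one,
            Matrix.mul_one, h1']
  have hVU : V * U = 1 := by
    calc V * U = (Q ⊗ₖ (1 : Matrix K' K' F)) * (Q' * P') * (P ⊗ₖ (1 : Matrix K' K' F)) := by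
          simp only [U, V, Matrix.mul_assoc]
      _ = 1 := by
          rw [h2', Matrix.mul_one, ← Matrix.mul_kronecker_mul, h2, Matrix.mul_one,
            Matrix.one_kronecker_one]
  have hU : Homog δ' (pmul (pmul γ η) η') U := by
    refine hP'.mul ?_
    rintro ⟨j, l⟩ ⟨x, l'⟩ hne
    rw [Matrix.kronecker_apply] at hne
    have h3 : l = l' := by
      by_contra hc
      exact right_ne_zero_of_mul hne (Matrix.one_apply_ne hc)
    simp only [pmul, h3, hP _ _ (left_ne_zero_of_mul hne)]
  have hV := hU.of_mul_eq_one hUV hVU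
  refine ⟨U.submatrix id σ, V.submatrix σ id, ?_, ?_, ?_, ?_, ?_⟩
  · rw [Matrix.submatrix_mul_equiv, hUV, Matrix.submatrix_id_id]
  · rw [Matrix.submatrix_mul _ _ _ id _ Function.bijective_id |>.symm, hVU]
    simp
  · rintro s ⟨i, k, k'⟩ hne
    refine (hU _ _ hne).trans ?_
    simp [pmul, σ, mul_assoc]
  · rintro ⟨i, k, k'⟩ s hne
    refine Eq.trans ?_ (hV _ _ hne)
    simp [pmul, σ, mul_assoc]
  · intro A
    have hA : A ⊗ₖ (1 : Matrix (K × K') (K × K') F)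
        = ((A ⊗ₖ (1 : Matrix K K F)) ⊗ₖ (1 : Matrix K' K' F)).submatrix σ σ := by
      ext ⟨i, k, k'⟩ ⟨j, l, l'⟩
      simp [σ, Matrix.one_apply, Prod.ext_iff, ← ite_and, and_comm]
    rw [hA, Matrix.submatrix_mul_equiv, Matrix.submatrix_mul_equiv, Matrix.submatrix_id_id]
    rw [AlgHom.comp_apply, hf', hf]
    calc _ = P' * ((P * (A ⊗ₖ (1 : Matrix K K F)) * Q) ⊗ₖ
            ((1 : Matrix K' K' F) * (1 : Matrix K' K' F) * (1 : Matrix K' K' F))) * Q' := by simp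
      _ = _ := by
          rw [Matrix.mul_kronecker_mul, Matrix.mul_kronecker_mul]
          simp only [U, V, Matrix.mul_assoc]

theorem HasMult.congr_labels {K' : Type} [Fintype K'] [DecidableEq K'] {η' : K' → G}
    (h : HasMult γ δ η f) (he : labels η = labels η') : HasMult γ δ η' f := by
  obtain ⟨P, Q, h1, h2, hP, hQ, hf⟩ := h
  obtain ⟨κ, hκ⟩ := exists_equiv_of_labels_eq he
  let σ : I × K' ≃ I × K := Equiv.prodCongr (Equiv.refl I) κ.symm
  refine ⟨P.submatrix id σ, Q.submatrix σ id, ?_, ?_, ?_, ?_, ?_⟩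
  · rw [Matrix.submatrix_mul_equiv, h1, Matrix.submatrix_id_id]
  · rw [Matrix.submatrix_mul _ _ _ id _ Function.bijective_id |>.symm, h2]
    simp
  · rintro s ⟨i, k⟩ hne
    refine (hP _ _ hne).trans ?_
    simp [pmul, σ, ← hκ]
  · rintro ⟨i, k⟩ s hne
    refine Eq.trans ?_ (hQ _ _ hne)
    simp [pmul, σ, ← hκ]
  · intro A
    have hA : A ⊗ₖ (1 : Matrix K' K' F) = (A ⊗ₖ (1 : Matrix K K F)).submatrix σ σ := by
      ext ⟨i, k⟩ ⟨j, l⟩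
      simp [σ, Matrix.one_apply]
    rw [hA, Matrix.submatrix_mul_equiv, Matrix.submatrix_mul_equiv, Matrix.submatrix_id_id, hf]

theorem HasMult.conj {K' : Type} [Fintype K'] [DecidableEq K'] {η' : K' → G}
    {f' : Matrix I I F →ₐ[F] Matrix J J F}
    (hf : HasMult γ δ η f) (hf' : HasMult γ δ η' f') (he : labels η = labels η') :
    ∃ u v : Matrix J J F, u * v = 1 ∧ v * u = 1 ∧ Homog δ δ u ∧ Homog δ δ v ∧
      ∀ A, f' A = u * f A * v := by
  obtain ⟨P, Q, h1, h2, hP, hQ, hf⟩ := hf.congr_labels he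
  obtain ⟨P', Q', h1', h2', hP', hQ', hf'⟩ := hf'
  refine ⟨P' * Q, P * Q', ?_, ?_, hP'.mul hQ, hP.mul hQ', ?_⟩
  · calc _ = P' * (Q * P) * Q' := by simp only [Matrix.mul_assoc]
      _ = 1 := by rw [h2, Matrix.mul_one, h1']
  · calc _ = P * (Q' * P') * Q := by simp only [Matrix.mul_assoc]
      _ = 1 := by rw [h2', Matrix.mul_one, h1]
  · intro A
    rw [hf, hf']
    calc _ = P' * (1 : Matrix (I × K') (I × K') F) * (A ⊗ₖ (1 : Matrix K' K' F)) *
          (1 : Matrix (I × K') (I × K') F) * Q' := by simp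
      _ = P' * (Q * P) * (A ⊗ₖ (1 : Matrix K' K' F)) * (Q * P) * Q' := by rw [h2]
      _ = _ := by simp only [Matrix.mul_assoc]

end Matrices

section NormalForm

open scoped Kronecker Matrix

variable {F : Type} [Field F] {G : Type} [CommGroup G] [DecidableEq G]
    {I J : Type} [Fintype I] [DecidableEq I] [Fintype J] [DecidableEq J]
    {γ : I → G} {δ : J → G} {f : Matrix I I F →ₐ[F] Matrix J J F}

theorem map_mul_single_apply (f : Matrix I I F →ₐ[F] Matrix J J F) (A : Matrix I I F) (j l : I)
    (s t : J) :
    (f A * f (Matrix.single j l 1)) s t = ∑ i, A i j * f (Matrix.single i l 1) s t := by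
  have h : A * Matrix.single j l 1 = ∑ i, A i j • Matrix.single i l (1 : F) := by
    ext x y
    rw [Matrix.sum_apply]
    by_cases hy : l = y
    · subst hy
      simp [Matrix.single_apply]
    · simp [hy, Matrix.mul_apply]
  rw [← map_mul, h, map_sum, Matrix.sum_apply]
  simp only [map_smul, Matrix.smul_apply, smul_eq_mul]

/-- Graded modules over an elementarily graded matrix algebra are multiples of the standard
one. -/
theorem exists_hasMult [Nonempty I]
    (hf : IsGradedHom F (elemGrading γ) (elemGrading δ) f) :
    ∃ (k : ℕ) (η : Fin k → G), HasMult γ δ η f := by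
  obtain ⟨i0⟩ := ‹Nonempty I›
  let W : I → I → Matrix J J F := fun i j => f (Matrix.single i j 1)
  have hW : ∀ i j l, W i j * W j l = W i l := by
    intro i j l
    simp [W, ← map_mul]
  have hW0 : ∀ i j j' l, j ≠ j' → W i j * W j' l = 0 := by
    intro i j j' l h
    simp [W, ← map_mul, h]
  obtain ⟨κ, a, ha, hspan, hli⟩ := exists_linearIndependent' F (W i0 i0).col
  have : Fintype κ := Fintype.ofInjective a ha
  let w : I × κ → (J → F) := fun p => (W p.1 i0).col (a p.2)
  have hw : ∀ (A B : Matrix J J F) t, A *ᵥ B.col t = (A * B).col t := fun A B t => rfl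
  have hwli : LinearIndependent F w := by
    rw [Fintype.linearIndependent_iff]
    rintro c hc ⟨j, k⟩
    refine Fintype.linearIndependent_iff.mp hli (fun k => c (j, k)) ?_ k
    have h1 := congrArg (W i0 j).mulVecLin hc
    rw [map_zero, map_sum, Fintype.sum_prod_type, Finset.sum_eq_single j] at h1
    · simpa [w, hw, hW] using h1
    · intro j' _ hne
      refine Finset.sum_eq_zero fun k _ => ?_
      rw [map_smul, Matrix.mulVecLin_apply, hw, hW0 _ _ _ _ hne.symm]
      ext s
      simp
    · simp
  have hwspan : ⊤ ≤ Submodule.span F (Set.range w) := by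
    intro z _
    have h1 : z = ∑ i, W i i *ᵥ z := by
      rw [← Matrix.sum_mulVec, ← map_sum, Matrix.sum_single_one, map_one, Matrix.one_mulVec]
    rw [h1]
    refine Submodule.sum_mem _ fun i _ => ?_
    have h2 : W i0 i *ᵥ z ∈ Submodule.span F (Set.range ((W i0 i0).col ∘ a)) := by
      rw [hspan, ← Matrix.range_mulVecLin]
      exact ⟨W i0 i *ᵥ z, by simp [hW]⟩
    have h3 := Submodule.mem_map_of_mem (f := (W i i0).mulVecLin) h2
    rw [Submodule.map_span, Matrix.mulVecLin_apply, Matrix.mulVec_mulVec, hW] at h3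
    refine Submodule.span_mono ?_ h3
    rintro _ ⟨_, ⟨k, rfl⟩, rfl⟩
    exact ⟨(i, k), by simp [w, hw, hW]⟩
  let b : Module.Basis (I × κ) F (J → F) := Module.Basis.mk hwli hwspan
  let η : κ → G := fun k => δ (a k) * (γ i0)⁻¹
  let P : Matrix J (I × κ) F := (Pi.basisFun F J).toMatrix b
  let Q : Matrix (I × κ) J F := b.toMatrix (Pi.basisFun F J)
  have hP : ∀ s p, P s p = W p.1 i0 s (a p.2) := by
    intro s p
    simp [P, Module.Basis.toMatrix_apply, b, w]
  have h1 : P * Q = 1 := Module.Basis.toMatrix_mul_toMatrix_flip _ _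
  have h2 : Q * P = 1 := Module.Basis.toMatrix_mul_toMatrix_flip _ _
  have hhom : Homog δ (pmul γ η) P := by
    rintro s ⟨i, k⟩ hne
    rw [hP] at hne
    have h3 : W i i0 ∈ elemGrading δ (γ i * (γ i0)⁻¹) :=
      hf _ ⟨_, single_mem_elemGrading γ i i0 1, rfl⟩
    rw [mem_elemGrading.mp h3 _ _ hne]
    simp only [pmul, η]
    rw [mul_assoc, mul_comm (γ i0)⁻¹]
  have hmult : HasMult γ δ η f := by
    refine ⟨P, Q, h1, h2, hhom, hhom.of_mul_eq_one h1 h2, fun A => ?_⟩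
    have h4 : f A * P = P * (A ⊗ₖ (1 : Matrix κ κ F)) := by
      ext s ⟨j, k⟩
      have h5 : (f A * P) s (j, k) = (f A * W j i0) s (a k) := by
        simp only [Matrix.mul_apply, hP]
      rw [h5, map_mul_single_apply, Matrix.mul_apply, Fintype.sum_prod_type]
      refine Finset.sum_congr rfl fun i _ => ?_
      simp [hP, W, Matrix.one_apply, mul_comm]
    rw [← h4, Matrix.mul_assoc, h1, Matrix.mul_one]
  obtain ⟨k, η', hη'⟩ := exists_labels_eq (labels η)
  exact ⟨k, η', hmult.congr_labels hη'.symm⟩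

end NormalForm

section Centralizer

open scoped Kronecker

variable {F : Type} [Field F] {G : Type} [CommGroup G] [DecidableEq G]

theorem HasMult.exists_hom_centralizer {I J K : Type} [Fintype I] [DecidableEq I]
    [Fintype J] [DecidableEq J] [Fintype K] [DecidableEq K]
    {γ : I → G} {δ : J → G} {η : K → G} {f : Matrix I I F →ₐ[F] Matrix J J F}
    (h : HasMult γ δ η f) :
    ∃ g : Matrix K K F →ₐ[F] Subalgebra.centralizer F (Set.range f),
      IsGradedHom F (elemGrading η)
        (subGrading (Subalgebra.centralizer F (Set.range f)) (elemGrading δ)) g := by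
  obtain ⟨P, Q, h1, h2, hP, hQ, hf⟩ := h
  have hm : ∀ X Y : Matrix (I × K) (I × K) F, P * X * Q * (P * Y * Q) = P * (X * Y) * Q := by
    intro X Y
    calc _ = P * X * (Q * P) * Y * Q := by simp only [Matrix.mul_assoc]
      _ = _ := by rw [h2, Matrix.mul_one]; simp only [Matrix.mul_assoc]
  let l : Matrix K K F →ₗ[F] Matrix J J F :=
    { toFun := fun C => P * ((1 : Matrix I I F) ⊗ₖ C) * Q
      map_add' := fun A B => by rw [Matrix.kronecker_add, Matrix.mul_add, Matrix.add_mul]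
      map_smul' := fun c A => by simp [Matrix.kronecker_smul] }
  let g : Matrix K K F →ₐ[F] Matrix J J F := AlgHom.ofLinearMap l (by simp [l, h1]) (by
    intro A B
    simp only [l, LinearMap.coe_mk, AddHom.coe_mk]
    rw [hm, ← Matrix.mul_kronecker_mul, Matrix.mul_one])
  have hg : ∀ C, g C = P * ((1 : Matrix I I F) ⊗ₖ C) * Q := fun C => rfl
  refine ⟨g.codRestrict _ ?_, ?_⟩
  · intro C
    rw [Subalgebra.mem_centralizer_iff]
    rintro _ ⟨A, rfl⟩
    rw [hf, hg, hm, hm, ← Matrix.mul_kronecker_mul, ← Matrix.mul_kronecker_mul]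
    simp
  · rintro d _ ⟨C, hC, rfl⟩
    rw [SetLike.mem_coe, mem_elemGrading] at hC
    change g C ∈ elemGrading δ d
    rw [hg, mem_elemGrading]
    intro s t hne
    rw [Matrix.mul_apply] at hne
    obtain ⟨⟨j, l⟩, -, h⟩ := Finset.exists_ne_zero_of_sum_ne_zero hne
    have hq := hQ _ _ (right_ne_zero_of_mul h)
    have h := left_ne_zero_of_mul h
    rw [Matrix.mul_apply] at h
    obtain ⟨⟨i, k⟩, -, h⟩ := Finset.exists_ne_zero_of_sum_ne_zero h
    have hp := hP _ _ (left_ne_zero_of_mul h)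
    have h := right_ne_zero_of_mul h
    rw [Matrix.kronecker_apply] at h
    have h3 := hC _ _ (right_ne_zero_of_mul h)
    have h4 : i = j := by
      by_contra hij
      exact left_ne_zero_of_mul h (Matrix.one_apply_ne hij)
    rw [hp, ← hq, pmul, pmul, h3, h4, mul_left_comm]

/-- The label of an embedding determines the support of the graded multiplicity space. -/
theorem HasLabel.suppM_eq {n m k k' : ℕ} {γ : Fin n → G} {δ : Fin m → G} {η : Fin k → G}
    {η' : Fin k' → G} {ι : Matrix (Fin n) (Fin n) F →ₐ[F] Matrix (Fin m) (Fin m) F}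
    (h : HasLabel γ δ η ι) (h' : HasMult γ δ η' ι)
    (hl : labels δ = mmul (labels γ) (labels η)) (hδ : labels δ ≠ 0) :
    suppM (labels η') = suppM (labels η) := by
  obtain ⟨g, hg⟩ := h'.exists_hom_centralizer
  obtain ⟨-, e, he⟩ := h
  have hcard : ∀ {x y z : Multiset G}, x = mmul y z → x.card = y.card * z.card := by
    intro x y z hxy
    have := congrArg (evChar 1) hxy
    rw [evChar_mmul, evChar_one, evChar_one, evChar_one] at this
    exact_mod_cast this
  have c0 : (labels δ).card ≠ 0 := by simpa using hδ
  have c1 := hcard hl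
  have c2 := hcard h'.labels_eq
  have hne : (labels γ).card ≠ 0 := by
    intro h0
    rw [h0, zero_mul] at c1
    exact c0 c1
  have c3 : (labels η').card = (labels η).card :=
    mul_left_cancel₀ hne (c2.symm.trans c1)
  have hne' : (labels η').card ≠ 0 := by
    intro h0
    rw [h0, mul_zero] at c2
    exact c0 c2
  have : Nonempty (Fin k') := by
    refine ⟨⟨0, Nat.pos_of_ne_zero ?_⟩⟩
    simpa [labels] using hne'
  obtain ⟨q, d, hd⟩ := exists_hasMult (γ := η') (δ := η) (f := e.toAlgHom.comp g) (by
    rintro x _ ⟨C, hC, rfl⟩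
    rw [← he x]
    exact ⟨g C, hg x ⟨C, hC, rfl⟩, rfl⟩)
  have c4 := hcard hd.labels_eq
  rw [c3] at c4
  have c5 : (labels d).card = 1 := by
    have h6 : (labels η).card ≠ 0 := c3 ▸ hne'
    exact mul_left_cancel₀ h6 (by rw [← c4, mul_one])
  obtain ⟨x, hx⟩ := Multiset.card_eq_one.mp c5
  ext χ
  have h7 : evChar χ (labels η) = evChar χ (labels η') * (χ x : ℂ) := by
    rw [hd.labels_eq, evChar_mmul, hx]
    simp [evChar]
  simp [suppM, h7]

end Centralizer

section Towers

variable {F : Type} [Field F] {G : Type} [CommGroup G] [DecidableEq G]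

/-- An exhausting tower of elementarily graded matrix algebras in a graded algebra, whose steps
have multiplicities supported on `S` and all of whose label multisets do not vanish on `S`. -/
structure IsTower {L : Type} [Ring L] [Algebra F L] (ℒ : G → Submodule F L)
    (S : Set (G →* ℂˣ)) {I : ℕ → Type} [∀ i, Fintype (I i)] [∀ i, DecidableEq (I i)]
    (γ : ∀ i, I i → G) (φ : ∀ i, Matrix (I i) (I i) F →ₐ[F] L) : Prop where
  nonempty : ∀ i, Nonempty (I i)
  injective : ∀ i, Function.Injective (φ i)
  step : ∀ i, ∃ (k : ℕ) (η : Fin k → G)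
    (ι : Matrix (I i) (I i) F →ₐ[F] Matrix (I (i + 1)) (I (i + 1)) F),
    HasMult (γ i) (γ (i + 1)) η ι ∧ suppM (labels η) ⊆ S ∧ (φ (i + 1)).comp ι = φ i
  subset_supp : ∀ i, S ⊆ suppM (labels (γ i))
  mem_iff : ∀ g z, z ∈ ℒ g ↔ ∃ i, ∃ A ∈ elemGrading (γ i) g, φ i A = z
  exhaust : ∀ z, ∃ i A, φ i A = z

namespace IsTower

variable {L : Type} [Ring L] [Algebra F L] {ℒ : G → Submodule F L}
    {S : Set (G →* ℂˣ)} {I : ℕ → Type} [∀ i, Fintype (I i)] [∀ i, DecidableEq (I i)]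
    {γ : ∀ i, I i → G} {φ : ∀ i, Matrix (I i) (I i) F →ₐ[F] L}

theorem exists_transition (T : IsTower ℒ S γ φ) {i j : ℕ} (hij : i ≤ j) :
    ∃ ι : Matrix (I i) (I i) F →ₐ[F] Matrix (I j) (I j) F,
      IsGradedHom F (elemGrading (γ i)) (elemGrading (γ j)) ι ∧ (φ j).comp ι = φ i := by
  induction j, hij using Nat.le_induction with
  | base =>
    refine ⟨AlgHom.id F _, ?_, AlgHom.comp_id _⟩
    rintro g _ ⟨A, hA, rfl⟩
    exact hA
  | succ j hij ih =>
    obtain ⟨ι, hι, h⟩ := ih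
    obtain ⟨k, η, ι', hι', -, h'⟩ := T.step j
    refine ⟨ι'.comp ι, ?_, ?_⟩
    · rintro g _ ⟨A, hA, rfl⟩
      exact hι'.isGradedHom g ⟨ι A, hι g ⟨A, hA, rfl⟩, rfl⟩
    · rw [← AlgHom.comp_assoc, h', h]

theorem isGradedHom (T : IsTower ℒ S γ φ) (i : ℕ) : IsGradedHom F (elemGrading (γ i)) ℒ (φ i) := by
  rintro g _ ⟨A, hA, rfl⟩
  exact (T.mem_iff g _).mpr ⟨i, A, hA, rfl⟩

theorem exists_lift_of_le (T : IsTower ℒ S γ φ) {i j : ℕ} (hij : i ≤ j) {g : G}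
    {A : Matrix (I i) (I i) F} (hA : A ∈ elemGrading (γ i) g) :
    ∃ B ∈ elemGrading (γ j) g, φ j B = φ i A := by
  obtain ⟨ι, hι, h⟩ := T.exists_transition hij
  exact ⟨ι A, hι g ⟨A, hA, rfl⟩, DFunLike.congr_fun h A⟩

theorem mul_mem (T : IsTower ℒ S γ φ) {g h : G} {y z : L} (hy : y ∈ ℒ g) (hz : z ∈ ℒ h) :
    y * z ∈ ℒ (g * h) := by
  obtain ⟨i, A, hA, rfl⟩ := (T.mem_iff _ _).mp hy
  obtain ⟨j, B, hB, rfl⟩ := (T.mem_iff _ _).mp hz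
  obtain ⟨A', hA', h1⟩ := T.exists_lift_of_le (le_max_left i j) hA
  obtain ⟨B', hB', h2⟩ := T.exists_lift_of_le (le_max_right i j) hB
  exact (T.mem_iff _ _).mpr ⟨_, A' * B', mul_mem_elemGrading hA' hB', by rw [map_mul, h1, h2]⟩

/-- A graded homomorphism from a matrix algebra into the union of a tower factors through a
stage of the tower. -/
theorem exists_factor (T : IsTower ℒ S γ φ) {J : Type} [Fintype J] [DecidableEq J]
    {δ : J → G} {f : Matrix J J F →ₐ[F] L} (hf : IsGradedHom F (elemGrading δ) ℒ f) (N : ℕ) :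
    ∃ i, N ≤ i ∧ ∃ f' : Matrix J J F →ₐ[F] Matrix (I i) (I i) F,
      IsGradedHom F (elemGrading δ) (elemGrading (γ i)) f' ∧ (φ i).comp f' = f := by
  have h1 : ∀ p : J × J, ∃ i, ∃ A ∈ elemGrading (γ i) (δ p.1 * (δ p.2)⁻¹),
      φ i A = f (Matrix.single p.1 p.2 1) := fun p =>
    (T.mem_iff _ _).mp (hf _ ⟨_, single_mem_elemGrading δ p.1 p.2 1, rfl⟩)
  choose n hn using h1
  let i := max N (Finset.univ.sup n)
  have h2 : ∀ p : J × J, ∃ A ∈ elemGrading (γ i) (δ p.1 * (δ p.2)⁻¹),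
      φ i A = f (Matrix.single p.1 p.2 1) := by
    intro p
    obtain ⟨A, hA, hAf⟩ := hn p
    obtain ⟨B, hB, h⟩ := T.exists_lift_of_le
      ((Finset.le_sup (Finset.mem_univ p)).trans (le_max_right N _)) hA
    exact ⟨B, hB, h.trans hAf⟩
  choose E hE hEf using h2
  have hsum : ∀ A : Matrix J J F, A = ∑ x, ∑ y, A x y • Matrix.single x y (1 : F) := by
    intro A
    conv_lhs => rw [Matrix.matrix_eq_sum_single A]
    simp [Matrix.smul_single]
  have hfA : ∀ A, f A = φ i (∑ x, ∑ y, A x y • E (x, y)) := by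
    intro A
    conv_lhs => rw [hsum A]
    simp only [map_sum, map_smul, hEf]
  let f' : Matrix J J F →ₐ[F] Matrix (I i) (I i) F :=
    ((AlgEquiv.ofInjective (φ i) (T.injective i)).symm : (φ i).range →ₐ[F] _).comp
      (f.codRestrict (φ i).range fun A => ⟨_, (hfA A).symm⟩)
  have hf' : ∀ A, φ i (f' A) = f A := by
    intro A
    have := (AlgEquiv.ofInjective (φ i) (T.injective i)).apply_symm_apply
      (f.codRestrict (φ i).range (fun A => ⟨_, (hfA A).symm⟩) A)
    exact congrArg Subtype.val this
  refine ⟨i, le_max_left _ _, f', ?_, AlgHom.ext hf'⟩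
  rintro g _ ⟨A, hA, rfl⟩
  change f' A ∈ elemGrading (γ i) g
  have h3 : f' A = ∑ x, ∑ y, A x y • E (x, y) := T.injective i ((hf' A).trans (hfA A))
  rw [h3]
  refine Submodule.sum_mem _ fun x _ => Submodule.sum_mem _ fun y _ => ?_
  by_cases h0 : A x y = 0
  · rw [h0, zero_smul]
    exact Submodule.zero_mem _
  · have h4 := mem_elemGrading.mp hA x y h0
    have h5 := hE (x, y)
    simp only [h4, mul_inv_cancel_right] at h5
    exact Submodule.smul_mem _ _ h5

/-- Any two graded homomorphisms from a matrix algebra into the union of a tower are conjugate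
by a unit of trivial degree. -/
theorem exists_conj [Finite G] (T : IsTower ℒ S γ φ) {J : Type} [Fintype J] [DecidableEq J]
    [Nonempty J] {δ : J → G} {f f' : Matrix J J F →ₐ[F] L}
    (hf : IsGradedHom F (elemGrading δ) ℒ f) (hf' : IsGradedHom F (elemGrading δ) ℒ f') :
    ∃ u v : L, u * v = 1 ∧ v * u = 1 ∧ u ∈ ℒ 1 ∧ v ∈ ℒ 1 ∧ ∀ A, f' A = u * f A * v := by
  obtain ⟨i, -, h, hh, rfl⟩ := T.exists_factor hf 0
  obtain ⟨j, hij, h', hh', rfl⟩ := T.exists_factor hf' i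
  obtain ⟨τ, hτ, hτφ⟩ := T.exists_transition hij
  obtain ⟨k, η, h1⟩ := exists_hasMult (f := τ.comp h) (γ := δ) (δ := γ j) (by
    rintro g _ ⟨A, hA, rfl⟩
    exact hτ g ⟨h A, hh g ⟨A, hA, rfl⟩, rfl⟩)
  obtain ⟨k', η', h1'⟩ := exists_hasMult hh'
  obtain ⟨q, θ, ι, hι, hθ, hιφ⟩ := T.step j
  obtain ⟨u, v, huv, hvu, hu, hv, hconj⟩ := (h1.comp hι).conj (h1'.comp hι) (by
    refine multiset_eq_of_evChar_eq fun χ => ?_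
    rw [evChar_labels_pmul, evChar_labels_pmul]
    by_cases hχ : evChar χ (labels θ) = 0
    · rw [hχ, mul_zero, mul_zero]
    · have h2 : evChar χ (labels (γ j)) ≠ 0 := T.subset_supp j (hθ hχ)
      have h3 := congrArg (evChar χ) h1.labels_eq
      have h4 := congrArg (evChar χ) h1'.labels_eq
      rw [evChar_mmul] at h3 h4
      have h5 : evChar χ (labels δ) ≠ 0 := by
        intro h0
        rw [h0, zero_mul] at h3
        exact h2 h3
      rw [mul_left_cancel₀ h5 (h3.symm.trans h4)])
  refine ⟨φ (j + 1) u, φ (j + 1) v, ?_, ?_, ?_, ?_, ?_⟩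
  · rw [← map_mul, huv, map_one]
  · rw [← map_mul, hvu, map_one]
  · exact T.isGradedHom _ 1 ⟨u, mem_elemGrading_one.mpr hu, rfl⟩
  · exact T.isGradedHom _ 1 ⟨v, mem_elemGrading_one.mpr hv, rfl⟩
  · intro A
    have h6 := congrArg (φ (j + 1)) (hconj A)
    rw [map_mul, map_mul] at h6
    have h7 : ∀ B, φ (j + 1) (ι B) = φ j B := DFunLike.congr_fun hιφ
    have h8 : ∀ B, φ j (τ B) = φ i B := DFunLike.congr_fun hτφ
    simpa [h7, h8] using h6

/-- A conjugate of a graded homomorphism by a unit of trivial degree. -/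
theorem exists_conj_hom (T : IsTower ℒ S γ φ) {J : Type} [Fintype J] [DecidableEq J]
    {δ : J → G} {f : Matrix J J F →ₐ[F] L}
    (hf : IsGradedHom F (elemGrading δ) ℒ f) {u v : L} (huv : u * v = 1) (hvu : v * u = 1)
    (hu : u ∈ ℒ 1) (hv : v ∈ ℒ 1) :
    ∃ f' : Matrix J J F →ₐ[F] L, IsGradedHom F (elemGrading δ) ℒ f' ∧
      ∀ A, f' A = u * f A * v := by
  let l : Matrix J J F →ₗ[F] L :=
    { toFun := fun A => u * f A * v
      map_add' := fun A B => by rw [map_add, mul_add, add_mul]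
      map_smul' := fun c A => by simp }
  refine ⟨AlgHom.ofLinearMap l (by simp [l, huv]) ?_, ?_, fun A => rfl⟩
  · intro A B
    simp only [l, LinearMap.coe_mk, AddHom.coe_mk, map_mul]
    calc _ = u * f A * (v * u) * f B * v := by rw [hvu]; simp only [mul_assoc, one_mul]
      _ = _ := by simp only [mul_assoc]
  · rintro g _ ⟨A, hA, rfl⟩
    have := T.mul_mem (T.mul_mem hu (hf g ⟨A, hA, rfl⟩)) hv
    rwa [one_mul, mul_one] at this

section Intertwining

variable {M : Type} [Ring M] [Algebra F M] {ℳ : G → Submodule F M}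
    {I' : ℕ → Type} [∀ i, Fintype (I' i)] [∀ i, DecidableEq (I' i)]
    {γ' : ∀ i, I' i → G} {ψ : ∀ i, Matrix (I' i) (I' i) F →ₐ[F] M}

theorem exists_extension [Finite G] (T : IsTower ℒ S γ φ) (T' : IsTower ℳ S γ' ψ)
    (hE : ∀ k, ∃ f : Matrix (I' k) (I' k) F →ₐ[F] L, IsGradedHom F (elemGrading (γ' k)) ℒ f)
    (hE' : ∀ m, ∃ g : Matrix (I m) (I m) F →ₐ[F] M, IsGradedHom F (elemGrading (γ m)) ℳ g)
    (k : ℕ) {f : Matrix (I' k) (I' k) F →ₐ[F] L} (hf : IsGradedHom F (elemGrading (γ' k)) ℒ f)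
    (N : ℕ) :
    ∃ (k' : ℕ) (f' : Matrix (I' k') (I' k') F →ₐ[F] L), k < k' ∧
      IsGradedHom F (elemGrading (γ' k')) ℒ f' ∧
      (∃ τ : Matrix (I' k) (I' k) F →ₐ[F] Matrix (I' k') (I' k') F,
        (ψ k').comp τ = ψ k ∧ f'.comp τ = f) ∧
      ∀ g, ∀ A ∈ elemGrading (γ N) g, ∃ B ∈ elemGrading (γ' k') g, f' B = φ N A := by
  obtain ⟨m, hNm, f₁, hf₁, hf₁φ⟩ := T.exists_factor hf N
  obtain ⟨g₀, hg₀⟩ := hE' m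
  have := T'.nonempty k
  have := T.nonempty m
  obtain ⟨u, v, huv, hvu, hu, hv, hconj⟩ := T'.exists_conj (f := g₀.comp f₁) (f' := ψ k)
    (δ := γ' k) (by
      rintro g _ ⟨A, hA, rfl⟩
      exact hg₀ g ⟨f₁ A, hf₁ g ⟨A, hA, rfl⟩, rfl⟩) (T'.isGradedHom k)
  obtain ⟨g₁, hg₁, hg₁'⟩ := T'.exists_conj_hom hg₀ huv hvu hu hv
  obtain ⟨k', hkk', g₂, hg₂, hg₂ψ⟩ := T'.exists_factor hg₁ (k + 1)
  obtain ⟨f₀, hf₀⟩ := hE k'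
  obtain ⟨u', v', huv', hvu', hu', hv', hconj'⟩ := T.exists_conj (f := f₀.comp g₂) (f' := φ m)
    (δ := γ m) (by
      rintro g _ ⟨A, hA, rfl⟩
      exact hf₀ g ⟨g₂ A, hg₂ g ⟨A, hA, rfl⟩, rfl⟩) (T.isGradedHom m)
  obtain ⟨f', hf', hf''⟩ := T.exists_conj_hom hf₀ huv' hvu' hu' hv'
  have key : ∀ A, f' (g₂ A) = φ m A := by
    intro A
    rw [hf'', hconj']
    rfl
  refine ⟨k', f', hkk', hf', ⟨g₂.comp f₁, ?_, ?_⟩, ?_⟩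
  · ext1 A
    have h1 := DFunLike.congr_fun hg₂ψ (f₁ A)
    simp only [AlgHom.comp_apply] at h1 ⊢
    rw [h1, hg₁', hconj]
    rfl
  · ext1 A
    simp only [AlgHom.comp_apply]
    rw [key]
    exact DFunLike.congr_fun hf₁φ A
  · intro g A hA
    obtain ⟨A', hA', h2⟩ := T.exists_lift_of_le hNm hA
    exact ⟨g₂ A', hg₂ g ⟨A', hA', rfl⟩, (key A').trans h2⟩

/-- Elliott's intertwining argument: two towers that map into each other have isomorphic
unions. -/
theorem isGradedAlgIso [Finite G] (T : IsTower ℒ S γ φ) (T' : IsTower ℳ S γ' ψ)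
    (hE : ∀ k, ∃ f : Matrix (I' k) (I' k) F →ₐ[F] L, IsGradedHom F (elemGrading (γ' k)) ℒ f)
    (hE' : ∀ m, ∃ g : Matrix (I m) (I m) F →ₐ[F] M, IsGradedHom F (elemGrading (γ m)) ℳ g) :
    IsGradedAlgIso F ℳ ℒ := by
  let State : Type := Σ k, {f : Matrix (I' k) (I' k) F →ₐ[F] L //
    IsGradedHom F (elemGrading (γ' k)) ℒ f}
  have hstep : ∀ (s : State) (N : ℕ), ∃ s' : State, s.1 < s'.1 ∧
      (∃ τ : Matrix (I' s.1) (I' s.1) F →ₐ[F] Matrix (I' s'.1) (I' s'.1) F,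
        (ψ s'.1).comp τ = ψ s.1 ∧ s'.2.1.comp τ = s.2.1) ∧
      ∀ g, ∀ A ∈ elemGrading (γ N) g, ∃ B ∈ elemGrading (γ' s'.1) g, s'.2.1 B = φ N A := by
    rintro ⟨k, f, hf⟩ N
    obtain ⟨k', f', hk, hf', h1, h2⟩ := T.exists_extension T' hE hE' k hf N
    exact ⟨⟨k', f', hf'⟩, hk, h1, h2⟩
  choose next hlt hτ hsurj using hstep
  obtain ⟨f₀, hf₀⟩ := hE 0
  let st : ℕ → State := fun n => Nat.rec ⟨0, f₀, hf₀⟩ (fun n s => next s n) n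
  have hst : ∀ n, st (n + 1) = next (st n) n := fun n => rfl
  let R : ℕ → Subalgebra F (M × L) := fun n => ((ψ (st n).1).prod (st n).2.1).range
  have hR : Monotone R := by
    refine monotone_nat_of_le_succ fun n => ?_
    rintro _ ⟨A, rfl⟩
    obtain ⟨τ, h1, h2⟩ := hτ (st n) n
    exact ⟨τ A, Prod.ext (DFunLike.congr_fun h1 A) (DFunLike.congr_fun h2 A)⟩
  let U : Subalgebra F (M × L) := ⨆ n, R n
  have hU : ∀ p : M × L, p ∈ U ↔ ∃ n A, ψ (st n).1 A = p.1 ∧ (st n).2.1 A = p.2 := by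
    intro p
    have h1 : p ∈ U ↔ ∃ n, p ∈ R n := by
      rw [← SetLike.mem_coe, Subalgebra.coe_iSup_of_directed hR.directed_le, Set.mem_iUnion]
      rfl
    rw [h1]
    refine exists_congr fun n => ?_
    constructor
    · rintro ⟨A, rfl⟩
      exact ⟨A, rfl, rfl⟩
    · rintro ⟨A, h, h'⟩
      exact ⟨A, Prod.ext h h'⟩
  have hge : ∀ n, n ≤ (st n).1 := by
    intro n
    induction n with
    | zero => exact Nat.zero_le _
    | succ n ih => exact Nat.succ_le_of_lt (ih.trans_lt (hlt (st n) n))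
  have hLnt : Nontrivial L := by
    have := T.nonempty 0
    exact (T.injective 0).nontrivial
  let p₁ : U →ₐ[F] M := (AlgHom.fst F M L).comp U.val
  let p₂ : U →ₐ[F] L := (AlgHom.snd F M L).comp U.val
  have b₁ : Function.Bijective p₁ := by
    constructor
    · rw [injective_iff_map_eq_zero]
      rintro ⟨⟨y, z⟩, hp⟩ h
      obtain ⟨n, A, h1, h2⟩ := (hU _).mp hp
      have hy : y = 0 := h
      have hA : A = 0 := T'.injective _ (by rw [h1, map_zero]; exact hy)
      rw [hA, map_zero] at h2
      exact Subtype.ext (Prod.ext hy h2.symm)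
    · intro y
      obtain ⟨k, A, rfl⟩ := T'.exhaust y
      obtain ⟨ι, -, h⟩ := T'.exists_transition (hge k)
      exact ⟨⟨(ψ k A, (st k).2.1 (ι A)), (hU _).mpr ⟨k, ι A, DFunLike.congr_fun h A, rfl⟩⟩, rfl⟩
  have hsurj' : ∀ g, ∀ z ∈ ℒ g, ∃ y ∈ ℳ g, (y, z) ∈ U := by
    intro g z hz
    obtain ⟨m, A, hA, rfl⟩ := (T.mem_iff _ _).mp hz
    obtain ⟨B, hB, h⟩ := hsurj (st m) m g A hA
    exact ⟨ψ _ B, T'.isGradedHom _ g ⟨B, hB, rfl⟩, (hU _).mpr ⟨m + 1, B, rfl, h⟩⟩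
  have b₂ : Function.Bijective p₂ := by
    constructor
    · rw [injective_iff_map_eq_zero]
      rintro ⟨⟨y, z⟩, hp⟩ h
      obtain ⟨n, A, h1, h2⟩ := (hU _).mp hp
      have hz : z = 0 := h
      have := T'.nonempty (st n).1
      have hA : A = 0 := by
        have hinj := (st n).2.1.toRingHom.injective
        exact hinj (by rw [map_zero]; exact h2.trans hz)
      rw [hA, map_zero] at h1
      exact Subtype.ext (Prod.ext h1.symm hz)
    · intro z
      obtain ⟨m, A, rfl⟩ := T.exhaust z
      have h1 : φ m A ∈ p₂.range := by
        rw [Matrix.matrix_eq_sum_single A, map_sum]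
        refine Subalgebra.sum_mem _ fun x _ => ?_
        rw [map_sum]
        refine Subalgebra.sum_mem _ fun y _ => ?_
        obtain ⟨w, -, hw⟩ := hsurj' _ _
          (T.isGradedHom m _ ⟨_, single_mem_elemGrading (γ m) x y (A x y), rfl⟩)
        exact ⟨⟨_, hw⟩, rfl⟩
      exact h1
  let e₁ := AlgEquiv.ofBijective p₁ b₁
  let e₂ := AlgEquiv.ofBijective p₂ b₂
  have he : ∀ {y z}, (y, z) ∈ U → (e₁.symm.trans e₂) y = z := by
    intro y z h
    have : e₁.symm y = ⟨(y, z), h⟩ := by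
      rw [AlgEquiv.symm_apply_eq]
      rfl
    rw [AlgEquiv.trans_apply, this]
    rfl
  refine ⟨e₁.symm.trans e₂, fun g => le_antisymm ?_ ?_⟩
  · rintro _ ⟨y, hy, rfl⟩
    obtain ⟨k, A, hA, rfl⟩ := (T'.mem_iff _ _).mp hy
    obtain ⟨B, hB, h⟩ := T'.exists_lift_of_le (hge k) hA
    have h1 : (ψ k A, (st k).2.1 B) ∈ U := (hU _).mpr ⟨k, B, h, rfl⟩
    change (e₁.symm.trans e₂) (ψ k A) ∈ ℒ g
    rw [he h1]
    exact (st k).2.2 g ⟨B, hB, rfl⟩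
  · intro z hz
    obtain ⟨y, hy, h⟩ := hsurj' g z hz
    exact ⟨y, hy, he h⟩

end Intertwining

end IsTower

end Towers

section Cone

variable {G : Type} [CommGroup G] {x a : ℕ → Multiset G} {S : Set (G →* ℂˣ)}

theorem suppM_eq_of_forall_mmul (hx : ∀ i, x (i + 1) = mmul (x i) (a i))
    (ha : ∀ i, suppM (a i) = S) (hx0 : suppM (x 0) = S) (i : ℕ) : suppM (x i) = S := by
  induction i with
  | zero => exact hx0
  | succ i ih =>
    ext χ
    have h1 := Set.ext_iff.mp ih χ
    have h2 := Set.ext_iff.mp (ha i) χ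
    simp only [suppM, Set.mem_ofPred_eq] at h1 h2 ⊢
    rw [hx, evChar_mmul, mul_ne_zero_iff, h1, h2, and_self]

theorem conj_evChar_eq_mul_bprod [Finite G] (hx : ∀ i, x (i + 1) = mmul (x i) (a i)) (χ : G →* ℂˣ) (i : ℕ) :
    (starRingEnd ℂ) (evChar χ (x i)) =
      (starRingEnd ℂ) (evChar χ (x 0)) * evChar χ (bprod a i) := by
  induction i with
  | zero => simp [bprod, evChar]
  | succ i ih =>
    rw [hx, evChar_mmul, map_mul, ih, bprod, evChar_mmul, evChar_mbarM, mul_assoc]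

theorem evChar_bprod_ne_zero [Finite G] (ha : ∀ i, suppM (a i) = S) {χ : G →* ℂˣ} (hχ : χ ∈ S) (i : ℕ) :
    evChar χ (bprod a i) ≠ 0 := by
  induction i with
  | zero => simp [bprod, evChar]
  | succ i ih =>
    rw [bprod, evChar_mmul, evChar_mbarM]
    have h : evChar χ (a i) ≠ 0 := by
      rw [← ha i] at hχ
      exact hχ
    exact mul_ne_zero ih ((map_ne_zero _).mpr h)

/-- The cone is stable under division by `\bar c` exactly when every `x j * c` divides some
`x i` in the group semiring. -/
theorem mscale_Kplus_eq_iff [Finite G] (hx : ∀ i, x (i + 1) = mmul (x i) (a i))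
    (ha : ∀ i, suppM (a i) = S) (hx0 : suppM (x 0) = S) (c : Multiset G) :
    mscale (mbarM c) (Kplus S a) = Kplus S a ↔
      ∀ j, ∃ i d, x i = mmul (mmul (x j) c) d := by
  have hxS := suppM_eq_of_forall_mmul hx ha hx0
  have hmem : ∀ {χ}, χ ∈ S → ∀ i, evChar χ (x i) ≠ 0 := by
    intro χ hχ i
    rw [← hxS i] at hχ
    exact hχ
  have hmem' : ∀ {χ}, χ ∉ S → ∀ i, evChar χ (x i) = 0 := by
    intro χ hχ i
    rw [← hxS i] at hχ
    exact not_not.mp hχ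
  constructor
  · intro h j
    have h1 : (fun χ => if χ ∈ S then evChar χ {1} / evChar χ (bprod a j) else 0) ∈ Kplus S a :=
      ⟨j, {1}, fun χ => rfl⟩
    rw [← h] at h1
    obtain ⟨f, ⟨i, d, hf⟩, hfj⟩ := h1
    refine ⟨i, mbarM d, multiset_eq_of_evChar_eq fun χ => ?_⟩
    rw [evChar_mmul, evChar_mmul, evChar_mbarM]
    by_cases hχ : χ ∈ S
    · have h2 := congrFun hfj χ
      simp only [hf, hχ, if_true, evChar_mbarM] at h2
      have hi := evChar_bprod_ne_zero ha hχ i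
      have hj := evChar_bprod_ne_zero ha hχ j
      have h1 : evChar χ ({1} : Multiset G) = 1 := by simp [evChar]
      rw [h1, ← mul_div_assoc, div_eq_div_iff hi hj, one_mul] at h2
      apply (starRingEnd ℂ).injective
      simp only [map_mul, Complex.conj_conj]
      rw [conj_evChar_eq_mul_bprod hx χ i, conj_evChar_eq_mul_bprod hx χ j, ← h2]
      ring
    · simp [hmem' hχ]
  · intro h
    apply Set.Subset.antisymm
    · rintro _ ⟨f, ⟨i, d, hf⟩, rfl⟩
      refine ⟨i, mmul (mbarM c) d, fun χ => ?_⟩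
      simp only [hf, evChar_mmul]
      split_ifs
      · rw [mul_div_assoc]
      · rw [mul_zero]
    · rintro f ⟨j, d, hf⟩
      obtain ⟨i, e, he⟩ := h j
      refine ⟨fun χ => if χ ∈ S then evChar χ (mmul d (mbarM e)) / evChar χ (bprod a i) else 0,
        ⟨i, mmul d (mbarM e), fun χ => rfl⟩, ?_⟩
      funext χ
      rw [hf]
      by_cases hχ : χ ∈ S
      · simp only [hχ, if_true, evChar_mmul, evChar_mbarM]
        have hi := evChar_bprod_ne_zero ha hχ i
        have hj := evChar_bprod_ne_zero ha hχ j
        have h0 : (starRingEnd ℂ) (evChar χ (x 0)) ≠ 0 := (map_ne_zero _).mpr (hmem hχ 0)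
        have h3 := congrArg (fun y => (starRingEnd ℂ) (evChar χ y)) he
        simp only [evChar_mmul, map_mul] at h3
        rw [conj_evChar_eq_mul_bprod hx χ i, conj_evChar_eq_mul_bprod hx χ j, mul_assoc,
          mul_assoc] at h3
        have h4 := mul_left_cancel₀ h0 h3
        rw [← mul_div_assoc, div_eq_div_iff hi hj, h4]
        ring
      · simp [hχ]

end Cone

section Amplification

open scoped Kronecker

variable {F : Type} [Field F] {G : Type} [CommGroup G] {C I J K : Type}
    [Fintype C] [DecidableEq C] [Fintype I] [DecidableEq I] [Fintype J] [DecidableEq J]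
    [Fintype K] [DecidableEq K] {L : Type} [Ring L] [Algebra F L]

/-- The homomorphism applying `φ` to every block of a block matrix. -/
def amp (C : Type) [Fintype C] [DecidableEq C] (φ : Matrix I I F →ₐ[F] L) :
    Matrix (C × I) (C × I) F →ₐ[F] Matrix C C L :=
  φ.mapMatrix.comp (Matrix.compAlgEquiv C I F F).symm.toAlgHom

theorem amp_injective {φ : Matrix I I F →ₐ[F] L} (h : Function.Injective φ) :
    Function.Injective (amp C φ) := by
  intro M N hMN
  ext ⟨p, i⟩ ⟨q, j⟩
  exact congrFun (congrFun (h (congrFun (congrFun hMN p) q)) i) j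

theorem HasMult.amp {γ : I → G} {δ : J → G} {η : K → G} {f : Matrix I I F →ₐ[F] Matrix J J F}
    (h : HasMult γ δ η f) (ε : C → G) :
    HasMult (pmul ε γ) (pmul ε δ) η
      ((Matrix.compAlgEquiv C J F F).toAlgHom.comp (amp C f)) := by
  obtain ⟨P, Q, hPQ, hQP, hP, hQ, hf⟩ := h
  let τ : (C × I) × K ≃ C × (I × K) := Equiv.prodAssoc C I K
  refine ⟨((1 : Matrix C C F) ⊗ₖ P).submatrix id τ, ((1 : Matrix C C F) ⊗ₖ Q).submatrix τ id,
    ?_, ?_, ?_, ?_, ?_⟩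
  · rw [Matrix.submatrix_mul_equiv, ← Matrix.mul_kronecker_mul, hPQ, one_mul,
      Matrix.one_kronecker_one, Matrix.submatrix_id_id]
  · rw [← Matrix.submatrix_mul _ _ _ _ _ Function.bijective_id, ← Matrix.mul_kronecker_mul, hQP,
      one_mul, Matrix.one_kronecker_one, Matrix.submatrix_one_equiv]
  · rintro ⟨p, s⟩ ⟨⟨q, i⟩, k⟩ h0
    simp only [Matrix.submatrix_apply, id_eq, τ, Equiv.prodAssoc_apply,
      Matrix.kroneckerMap_apply, ne_eq, mul_eq_zero, not_or, Matrix.one_apply] at h0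
    have hpq : p = q := by
      by_contra hne
      exact h0.1 (if_neg hne)
    have := hP _ _ h0.2
    simp only [pmul] at this ⊢
    rw [this, hpq, mul_assoc]
  · rintro ⟨⟨q, i⟩, k⟩ ⟨p, s⟩ h0
    simp only [Matrix.submatrix_apply, id_eq, τ, Equiv.prodAssoc_apply,
      Matrix.kroneckerMap_apply, ne_eq, mul_eq_zero, not_or, Matrix.one_apply] at h0
    have hpq : q = p := by
      by_contra hne
      exact h0.1 (if_neg hne)
    have := hQ _ _ h0.2
    simp only [pmul] at this ⊢
    rw [← this, hpq, mul_assoc]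
  · intro A
    ext ⟨p, s⟩ ⟨q, t⟩
    change f (Matrix.of fun i j => A (p, i) (q, j)) s t = _
    rw [hf]
    simp [Matrix.mul_apply, Fintype.sum_prod_type, τ, Matrix.one_apply, Finset.sum_mul,
      Finset.sum_ite_irrel]

end Amplification

section MatrixTowers

variable {F : Type} [Field F] {G : Type} [CommGroup G] [DecidableEq G]
    {L : Type} [Ring L] [Algebra F L] {ℒ : G → Submodule F L}

theorem IsGradedHom.amp {I C : Type} [Fintype I] [DecidableEq I] [Fintype C] [DecidableEq C]
    {γ : I → G} {φ : Matrix I I F →ₐ[F] L} (hφ : IsGradedHom F (elemGrading γ) ℒ φ) (ε : C → G) :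
    IsGradedHom F (elemGrading (pmul ε γ)) (matrixGrading ε ℒ) (amp C φ) := by
  rintro g _ ⟨A, hA, rfl⟩
  intro p q
  refine hφ _ ⟨Matrix.of fun i j => A (p, i) (q, j), mem_elemGrading.mpr ?_, rfl⟩
  intro i j h
  have := mem_elemGrading.mp hA (p, i) (q, j) h
  simp only [pmul] at this
  rw [mul_assoc, mul_assoc, eq_inv_mul_iff_mul_eq, this]

theorem IsTower.matrix {S : Set (G →* ℂˣ)} {I : ℕ → Type} [∀ i, Fintype (I i)]
    [∀ i, DecidableEq (I i)] {γ : ∀ i, I i → G} {φ : ∀ i, Matrix (I i) (I i) F →ₐ[F] L}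
    (T : IsTower ℒ S γ φ) {C : Type} [Fintype C] [DecidableEq C] [Nonempty C] (ε : C → G)
    (hS : S ⊆ suppM (labels ε)) :
    IsTower (matrixGrading ε ℒ) S (fun i => pmul ε (γ i)) (fun i => amp C (φ i)) := by
  have hlift : ∀ {i j : ℕ}, i ≤ j → ∀ A, ∃ B, φ j B = φ i A := by
    intro i j hij A
    obtain ⟨ι, -, h⟩ := T.exists_transition hij
    exact ⟨ι A, DFunLike.congr_fun h A⟩
  refine ⟨fun i => ?_, fun i => amp_injective (T.injective i), fun i => ?_, fun i χ hχ => ?_,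
    fun g z => ⟨fun hz => ?_, ?_⟩, fun z => ?_⟩
  · have := T.nonempty i
    infer_instance
  · obtain ⟨k, η, ι, h, hη, hφ⟩ := T.step i
    refine ⟨k, η, _, h.amp ε, hη, ?_⟩
    ext1 A
    ext1 p q
    exact DFunLike.congr_fun hφ (Matrix.of fun i j => A (p, i) (q, j))
  · have h1 : evChar χ (labels (γ i)) ≠ 0 := T.subset_supp i hχ
    have h2 : evChar χ (labels ε) ≠ 0 := hS hχ
    change evChar χ _ ≠ 0
    rw [evChar_labels_pmul]
    exact mul_ne_zero h2 h1
  · have h1 := fun p : C × C => (T.mem_iff _ _).mp (hz p.1 p.2)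
    choose n hn using h1
    have h2 : ∀ p q : C, ∃ A ∈ elemGrading (γ (Finset.univ.sup n)) ((ε p)⁻¹ * g * ε q),
        φ _ A = z p q := by
      intro p q
      obtain ⟨A, hA, hAz⟩ := hn (p, q)
      obtain ⟨B, hB, h⟩ := T.exists_lift_of_le (Finset.le_sup (Finset.mem_univ (p, q))) hA
      exact ⟨B, hB, h.trans hAz⟩
    choose A hA hAz using h2
    refine ⟨Finset.univ.sup n, Matrix.of fun p q => A p.1 q.1 p.2 q.2,
      mem_elemGrading.mpr ?_, ?_⟩
    · rintro ⟨p, i⟩ ⟨q, j⟩ h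
      have := mem_elemGrading.mp (hA p q) i j h
      simp only [pmul]
      rw [this]
      group
    · ext p q
      exact hAz p q
  · rintro ⟨i, A, hA, rfl⟩
    exact (T.isGradedHom i).amp ε g ⟨A, hA, rfl⟩
  · have h1 := fun p : C × C => T.exhaust (z p.1 p.2)
    choose n B hB using h1
    have h2 : ∀ p q : C, ∃ A, φ (Finset.univ.sup n) A = z p q := by
      intro p q
      obtain ⟨A, hA⟩ := hlift (Finset.le_sup (f := n) (Finset.mem_univ (p, q))) (B (p, q))
      exact ⟨A, hA.trans (hB (p, q))⟩
    choose A hA using h2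
    refine ⟨Finset.univ.sup n, Matrix.of fun p q => A p.1 q.1 p.2 q.2, ?_⟩
    ext p q
    exact hA p q

theorem IsElemLimit.exists_isTower [Finite G] {x a : ℕ → Multiset G} {S : Set (G →* ℂˣ)}
    (hlim : IsElemLimit F L ℒ x a) (ha : ∀ i, suppM (a i) = S) (hx0 : suppM (x 0) = S)
    (hne : x 0 ≠ 0) :
    ∃ (n : ℕ → ℕ) (γ : ∀ i, Fin (n i) → G) (φ : ∀ i, Matrix (Fin (n i)) (Fin (n i)) F →ₐ[F] L),
      (∀ i, labels (γ i) = x i) ∧ IsTower ℒ S γ φ := by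
  obtain ⟨hx, n, γ, k, η, ι, hγ, hη, -, hlab, φ, hinj, hcomp, hex, hhom⟩ := hlim
  have hxS := suppM_eq_of_forall_mmul hx ha hx0
  have h1S : (1 : G →* ℂˣ) ∈ S := by
    rw [← hx0]
    change evChar 1 (x 0) ≠ 0
    rw [evChar_one]
    exact_mod_cast fun h => hne (Multiset.card_eq_zero.mp h)
  have hxne : ∀ i, x i ≠ 0 := by
    intro i h
    rw [← hxS i, h] at h1S
    exact h1S (by simp [evChar])
  have hγ' : ∀ i, labels (γ i) = x i := hγ
  have hη' : ∀ i, labels (η i) = a i := hη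
  have hn : ∀ i, Nonempty (Fin (n i)) := by
    intro i
    by_contra h
    rw [not_nonempty_iff] at h
    exact hxne i (by rw [← hγ' i]; simp [labels])
  refine ⟨n, γ, φ, hγ', hn, hinj, fun i => ?_, fun i => ?_, fun g z => ?_, fun z => ?_⟩
  · have := hn i
    obtain ⟨k', η', h⟩ := exists_hasMult (hlab i).1
    refine ⟨k', η', ι i, h, ?_, hcomp i⟩
    rw [(hlab i).suppM_eq h (by rw [hγ', hγ', hη', hx]) (by rw [hγ']; exact hxne _), hη', ha]
  · rw [hγ', hxS]
  · rw [← SetLike.mem_coe, hhom g, Set.mem_iUnion]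
    rfl
  · obtain ⟨i, A, hA⟩ := hex z
    exact ⟨i, A, hA⟩

/-- The tensor product with an elementarily graded matrix algebra is a graded matrix algebra. -/
theorem map_matrixGrading_matrixEquivTensor {C : Type} [Fintype C] [DecidableEq C] (ε : C → G)
    (g : G) : (matrixGrading ε ℒ g).map (matrixEquivTensor C F L).toLinearMap =
      tensorGrading F ℒ (elemGrading ε) g := by
  apply le_antisymm
  · rintro _ ⟨M, hM, rfl⟩
    change matrixEquivTensor C F L M ∈ _
    rw [matrixEquivTensor_apply]
    refine Submodule.sum_mem _ fun p _ => ?_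
    have hp : ((ε p.1)⁻¹ * g * ε p.2) * (ε p.1 * (ε p.2)⁻¹) = g := by
      rw [mul_comm (ε p.1), ← mul_assoc, mul_inv_cancel_right, mul_comm, mul_inv_cancel_left]
    exact Submodule.mem_iSup_of_mem ⟨(_, _), hp⟩ (Submodule.apply_mem_map₂ _ (hM p.1 p.2)
      (single_mem_elemGrading ε p.1 p.2 1))
  · refine iSup_le ?_
    rintro ⟨⟨h, k⟩, hk⟩
    rw [Submodule.map₂_le]
    intro y hy A hA
    refine ⟨(matrixEquivTensor C F L).symm (y ⊗ₜ A), ?_,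
      (matrixEquivTensor C F L).apply_symm_apply _⟩
    rw [matrixEquivTensor_apply_symm]
    intro i j
    simp only [Matrix.smul_apply, Matrix.map_apply, smul_eq_mul]
    by_cases h0 : A i j = 0
    · rw [h0, map_zero, mul_zero]
      exact Submodule.zero_mem _
    · have h1 := mem_elemGrading.mp hA i j h0
      have h2 : (ε i)⁻¹ * g * ε j = h := by
        dsimp only at hk h1
        rw [← hk, h1, mul_assoc, inv_mul_eq_iff_eq_mul, mul_comm h, mul_assoc, mul_assoc,
          mul_comm h]
      rw [h2, ← Algebra.commutes, ← Algebra.smul_def]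
      exact Submodule.smul_mem _ _ hy

theorem IsGradedHom.scalar {I C : Type} [Fintype I] [DecidableEq I] [Fintype C] [DecidableEq C]
    {γ : I → G} {φ : Matrix I I F →ₐ[F] L} (hφ : IsGradedHom F (elemGrading γ) ℒ φ) (ε : C → G) :
    IsGradedHom F (elemGrading γ) (matrixGrading ε ℒ)
      ((Matrix.diagonalAlgHom F).comp (AlgHom.pi fun _ : C => φ)) := by
  rintro g _ ⟨A, hA, rfl⟩
  intro p q
  change Matrix.diagonal (fun _ => φ A) p q ∈ _
  by_cases hpq : p = q
  · subst hpq
    rw [Matrix.diagonal_apply_eq, mul_comm, mul_inv_cancel_left]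
    exact hφ g ⟨A, hA, rfl⟩
  · rw [Matrix.diagonal_apply_ne _ hpq]
    exact Submodule.zero_mem _

end MatrixTowers

section Absorption

variable {F : Type} [Field F] {G : Type} [CommGroup G]

theorem IsGradedAlgIso.symm {A B : Type} [Ring A] [Algebra F A] [Ring B] [Algebra F B]
    {𝒜 : G → Submodule F A} {ℬ : G → Submodule F B} (h : IsGradedAlgIso F 𝒜 ℬ) :
    IsGradedAlgIso F ℬ 𝒜 := by
  obtain ⟨e, he⟩ := h
  refine ⟨e.symm, fun g => ?_⟩
  have h : e.symm.toLinearMap ∘ₗ e.toLinearMap = LinearMap.id :=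
    LinearMap.ext e.symm_apply_apply
  rw [← he g, ← Submodule.map_comp, h, Submodule.map_id]

theorem IsGradedAlgIso.trans {A B C : Type} [Ring A] [Algebra F A] [Ring B] [Algebra F B]
    [Ring C] [Algebra F C] {𝒜 : G → Submodule F A} {ℬ : G → Submodule F B}
    {𝒞 : G → Submodule F C} (h : IsGradedAlgIso F 𝒜 ℬ) (h' : IsGradedAlgIso F ℬ 𝒞) :
    IsGradedAlgIso F 𝒜 𝒞 := by
  obtain ⟨e, he⟩ := h
  obtain ⟨e', he'⟩ := h'
  refine ⟨e.trans e', fun g => ?_⟩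
  rw [← he' g, ← he g, ← Submodule.map_comp]
  rfl

theorem isGradedAlgIso_tensorGrading_iff [DecidableEq G] {L : Type} [Ring L]
    [Algebra F L] {ℒ : G → Submodule F L} {C : Type} [Fintype C] [DecidableEq C] (ε : C → G) :
    IsGradedAlgIso F (tensorGrading F ℒ (elemGrading ε)) ℒ ↔
      IsGradedAlgIso F (matrixGrading ε ℒ) ℒ := by
  have h : IsGradedAlgIso F (matrixGrading ε ℒ) (tensorGrading F ℒ (elemGrading ε)) :=
    ⟨matrixEquivTensor C F L, map_matrixGrading_matrixEquivTensor ε⟩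
  exact ⟨h.trans, h.symm.trans⟩

/-- The union of a tower absorbs `M_ε` iff every stage tensored with `M_ε` embeds in a
later stage. -/
theorem IsTower.isGradedAlgIso_matrixGrading_iff [DecidableEq G] [Finite G] {L : Type} [Ring L]
    [Algebra F L] {ℒ : G → Submodule F L} {S : Set (G →* ℂˣ)} {I : ℕ → Type} [∀ i, Fintype (I i)]
    [∀ i, DecidableEq (I i)] {γ : ∀ i, I i → G} {φ : ∀ i, Matrix (I i) (I i) F →ₐ[F] L}
    (T : IsTower ℒ S γ φ) {C : Type} [Fintype C] [DecidableEq C] [Nonempty C] (ε : C → G) :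
    IsGradedAlgIso F (matrixGrading ε ℒ) ℒ ↔
      ∀ j, ∃ i d, labels (γ i) = mmul (labels (pmul ε (γ j))) d := by
  constructor
  · rintro ⟨e, he⟩ j
    have := T.nonempty j
    obtain ⟨i, -, f, hf, -⟩ := T.exists_factor (δ := pmul ε (γ j))
      (f := e.toAlgHom.comp (amp C (φ j))) (by
        rintro g _ ⟨A, hA, rfl⟩
        rw [← he g]
        exact ⟨_, (T.isGradedHom j).amp ε g ⟨A, hA, rfl⟩, rfl⟩) 0
    obtain ⟨k, η, h⟩ := exists_hasMult hf
    exact ⟨i, labels η, h.labels_eq⟩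
  · intro h
    refine T.isGradedAlgIso (T.matrix ε fun χ hχ => ?_) (fun j => ?_)
      fun m => ⟨_, (T.isGradedHom m).scalar ε⟩
    · obtain ⟨i, d, hd⟩ := h 0
      have h1 : evChar χ (labels (γ i)) ≠ 0 := T.subset_supp i hχ
      rw [hd, evChar_mmul, evChar_labels_pmul, mul_ne_zero_iff, mul_ne_zero_iff] at h1
      exact h1.1.1
    · obtain ⟨i, d, hd⟩ := h j
      obtain ⟨k, η, rfl⟩ := exists_labels_eq d
      obtain ⟨f, hf⟩ := exists_hasMult_of_labels_eq (F := F) η hd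
      refine ⟨(φ i).comp f, ?_⟩
      rintro g _ ⟨A, hA, rfl⟩
      exact T.isGradedHom i g ⟨f A, hf.isGradedHom g ⟨A, hA, rfl⟩, rfl⟩

theorem IsElemLimit.subsingleton [DecidableEq G] {L : Type} [Ring L] [Algebra F L]
    {ℒ : G → Submodule F L} {x a : ℕ → Multiset G} (h : IsElemLimit F L ℒ x a) (hx : x 0 = 0) : Subsingleton L := by
  obtain ⟨-, n, γ, -, -, -, hγ, -, -, -, φ, -⟩ := h
  have hn : n 0 = 0 := by
    have := congrArg Multiset.card (hγ 0)
    simpa [hx] using this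
  have : IsEmpty (Fin (n 0)) := by
    rw [hn]
    infer_instance
  refine subsingleton_of_zero_eq_one ?_
  rw [← map_zero (φ 0), ← map_one (φ 0)]
  exact congrArg _ (Subsingleton.elim _ _)

theorem isGradedAlgIso_of_subsingleton {A B : Type} [Ring A] [Algebra F A] [Ring B] [Algebra F B]
    [Subsingleton A] [Subsingleton B] (𝒜 : G → Submodule F A) (ℬ : G → Submodule F B) :
    IsGradedAlgIso F 𝒜 ℬ :=
  ⟨AlgEquiv.ofAlgHom
    { toFun := fun _ => 0, map_one' := Subsingleton.elim _ _, map_mul' := by simp,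
      map_zero' := rfl, map_add' := by simp, commutes' := fun _ => Subsingleton.elim _ _ }
    { toFun := fun _ => 0, map_one' := Subsingleton.elim _ _, map_mul' := by simp,
      map_zero' := rfl, map_add' := by simp, commutes' := fun _ => Subsingleton.elim _ _ }
    (AlgHom.ext fun _ => Subsingleton.elim _ _) (AlgHom.ext fun _ => Subsingleton.elim _ _),
    fun _ => Subsingleton.elim _ _⟩

end Absorption

/-- Let `A = M_{x 0} ⊗ ⊗_i M_{a i}` be a direct limit of elementarily
`G`-graded matrix algebras with `supp(x 0) = supp(a i) = S` for all `i`, and let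
`c ∈ ℤ≥0 G` be nonzero. Then `A ⊗ M_c ≅ A` as `G`-graded algebras iff
`\bar c K⁺ = K⁺`, where `K⁺` is the positive cone of `K₀ᵍʳ(A)` realized inside `L_S`. -/
theorem elemLimit_absorbs_matrix_iff
    {F : Type} [Field F] {G : Type} [CommGroup G] [Fintype G] [DecidableEq G]
    {L : Type} [Ring L] [Algebra F L] (ℒ : G → Submodule F L)
    (x a : ℕ → Multiset G) (S : Set (G →* ℂˣ))
    (hlim : IsElemLimit F L ℒ x a)
    (hstS : ∀ i, suppM (a i) = S) (hstx : suppM (x 0) = S)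
    (c : Multiset G) (hc : c ≠ 0) {nc : ℕ} (γc : Fin nc → G) (hγc : Reps γc c) :
    IsGradedAlgIso F (tensorGrading F ℒ (elemGrading γc)) ℒ ↔
      mscale (mbarM c) (Kplus S a) = Kplus S a := by
  have hx := hlim.1
  rw [mscale_Kplus_eq_iff hx hstS hstx]
  by_cases hx0 : x 0 = 0
  · have := hlim.subsingleton hx0
    have : Subsingleton (L ⊗[F] Matrix (Fin nc) (Fin nc) F) :=
      (matrixEquivTensor (Fin nc) F L).symm.injective.subsingleton
    refine iff_of_true (isGradedAlgIso_of_subsingleton _ _) fun j => ⟨j, 0, ?_⟩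
    refine multiset_eq_of_evChar_eq fun χ => ?_
    have hχ : χ ∉ S := by
      rw [← hstx, hx0]
      simp [suppM, evChar]
    rw [← suppM_eq_of_forall_mmul hx hstS hstx j] at hχ
    rw [not_not.mp hχ, evChar_mmul]
    simp [evChar]
  · obtain ⟨n, γ, φ, hγ, T⟩ := hlim.exists_isTower hstS hstx hx0
    have hγc' : labels γc = c := hγc
    have : Nonempty (Fin nc) := by
      by_contra h
      rw [not_nonempty_iff] at h
      exact hc (by rw [← hγc']; simp [labels])
    rw [isGradedAlgIso_tensorGrading_iff, T.isGradedAlgIso_matrixGrading_iff]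
    have hmul : ∀ j, labels (pmul γc (γ j)) = mmul (x j) c := by
      intro j
      refine multiset_eq_of_evChar_eq fun χ => ?_
      rw [evChar_labels_pmul, evChar_mmul, hγc', hγ, mul_comm]
    simp only [hγ, hmul]
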